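/- arXiv:2409.18525 — 2 statements merged into one kernel-verified Lean document; each statement's English description precedes it below -/
import Mathlib

section
/- Let Ω ⊆ ℝⁿ be open, let φ ∈ Φ_w(Ω) satisfy (A0), (A1)_ω, (A2)_ω and (aInc)_p with p ∈ (1,∞), and let ω ∈ A_p. Then the Hardy–Littlewood maximal operator is bounded on the weighted generalized Orlicz space: there exists a constant C > 0 such that ‖Mf‖_{L^φ(Ω,ω)} ≤ C ‖f‖_{L^φ(Ω,ω)} for all f ∈ L^φ(Ω,ω). -/
open MeasureTheory Metric Filter Set
open scoped ENNReal NNReal Topology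

noncomputable section

/-- `ℝⁿ` with Lebesgue measure. -/
abbrev Rn (n : ℕ) : Type := EuclideanSpace ℝ (Fin n)

/-- The `ω`-measure of a set `E`, `ω(E) = ∫_E ω(x) dx`. -/
def wSet {n : ℕ} (ω : Rn n → ℝ≥0∞) (E : Set (Rn n)) : ℝ≥0∞ := ∫⁻ x in E, ω x

/-- A weight: a measurable, a.e. positive and finite, locally integrable function. -/
def IsWeight {n : ℕ} (ω : Rn n → ℝ≥0∞) : Prop :=
  Measurable ω ∧ (∀ᵐ x ∂(volume : Measure (Rn n)), 0 < ω x ∧ ω x < ∞) ∧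
    ∀ (z : Rn n) (r : ℝ), 0 < r → wSet ω (ball z r) ≠ ∞

/-- The Muckenhoupt class `A_q`, `1 < q < ∞`:
`sup_B |B|^{-q} ω(B) (∫_B ω^{-q'/q})^{q-1} < ∞` where `q'/q = 1/(q-1)`. -/
def MuckenhouptAq {n : ℕ} (q : ℝ) (ω : Rn n → ℝ≥0∞) : Prop :=
  IsWeight ω ∧ ∃ C : ℝ≥0∞, C ≠ ∞ ∧ ∀ (z : Rn n) (r : ℝ), 0 < r →
    (volume (ball z r)) ^ (-q) * wSet ω (ball z r) *
      (∫⁻ y in ball z r, (ω y) ^ (-(1 / (q - 1)))) ^ (q - 1) ≤ C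

/-- The class `A_∞ = ⋃_{1<q<∞} A_q`. -/
def MuckenhouptAinfty {n : ℕ} (ω : Rn n → ℝ≥0∞) : Prop :=
  ∃ q : ℝ, 1 < q ∧ MuckenhouptAq q ω

/-- `(aInc)_p`: `t ↦ φ(x,t)/t^p` is almost increasing, uniformly in a.e. `x ∈ Ω`. -/
def AInc {n : ℕ} (Ω : Set (Rn n)) (φ : Rn n → ℝ≥0∞ → ℝ≥0∞) (p : ℝ) : Prop :=
  ∃ a : ℝ≥0, 1 ≤ a ∧ ∀ᵐ x ∂(volume : Measure (Rn n)), x ∈ Ω →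
    ∀ s t : ℝ≥0, 0 < s → s < t →
      φ x s / (s : ℝ≥0∞) ^ p ≤ a * (φ x t / (t : ℝ≥0∞) ^ p)

/-- A weak Φ-function on `Ω`. -/
structure IsWeakPhi {n : ℕ} (Ω : Set (Rn n)) (φ : Rn n → ℝ≥0∞ → ℝ≥0∞) : Prop where
  meas : ∀ f : Rn n → ℝ≥0∞, Measurable f → Measurable fun x => φ x (f x)
  mono : ∀ᵐ x ∂(volume : Measure (Rn n)), x ∈ Ω → Monotone (φ x)
  map_zero : ∀ᵐ x ∂(volume : Measure (Rn n)), x ∈ Ω → φ x 0 = 0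
  tendsto_zero : ∀ᵐ x ∂(volume : Measure (Rn n)), x ∈ Ω →
    Tendsto (fun t : ℝ≥0 => φ x t) (𝓝[>] 0) (𝓝 0)
  tendsto_top : ∀ᵐ x ∂(volume : Measure (Rn n)), x ∈ Ω →
    Tendsto (fun t : ℝ≥0 => φ x t) atTop (𝓝 ∞)
  aInc_one : AInc Ω φ 1

/-- Condition (A0). -/
def A0 {n : ℕ} (Ω : Set (Rn n)) (φ : Rn n → ℝ≥0∞ → ℝ≥0∞) : Prop :=
  ∃ β₀ : ℝ≥0, 0 < β₀ ∧ β₀ ≤ 1 ∧ ∀ᵐ x ∂(volume : Measure (Rn n)), x ∈ Ω →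
    φ x β₀ ≤ 1 ∧ 1 ≤ φ x ((β₀ : ℝ≥0∞)⁻¹)

/-- Condition (A1)_ω. -/
def A1w {n : ℕ} (Ω : Set (Rn n)) (ω : Rn n → ℝ≥0∞) (φ : Rn n → ℝ≥0∞ → ℝ≥0∞) : Prop :=
  ∃ β₁ : ℝ≥0, 0 < β₁ ∧ β₁ ≤ 1 ∧ ∀ (z : Rn n) (r : ℝ), 0 < r → wSet ω (ball z r) ≤ 1 →
    ∀ᵐ x ∂(volume : Measure (Rn n)), ∀ᵐ y ∂(volume : Measure (Rn n)),
      x ∈ ball z r ∩ Ω → y ∈ ball z r ∩ Ω →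
        ∀ t : ℝ≥0, 1 ≤ φ y t → φ y t ≤ (wSet ω (ball z r))⁻¹ →
          φ x (β₁ * t) ≤ φ y t

/-- `h ∈ L¹(Ω,ω) ∩ L^∞(Ω)`, `h ≥ 0`. -/
def MemL1wLinf {n : ℕ} (Ω : Set (Rn n)) (ω : Rn n → ℝ≥0∞) (h : Rn n → ℝ≥0) : Prop :=
  Measurable h ∧ (∫⁻ x in Ω, (h x : ℝ≥0∞) * ω x) ≠ ∞ ∧
    ∃ C : ℝ≥0, ∀ᵐ x ∂(volume : Measure (Rn n)), x ∈ Ω → h x ≤ C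

/-- Condition (A2)_ω. -/
def A2w {n : ℕ} (Ω : Set (Rn n)) (ω : Rn n → ℝ≥0∞) (φ : Rn n → ℝ≥0∞ → ℝ≥0∞) : Prop :=
  ∀ s : ℝ≥0, 0 < s → ∃ β₂ : ℝ≥0, 0 < β₂ ∧ β₂ ≤ 1 ∧ ∃ h : Rn n → ℝ≥0,
    MemL1wLinf Ω ω h ∧
      ∀ᵐ x ∂(volume : Measure (Rn n)), ∀ᵐ y ∂(volume : Measure (Rn n)),
        x ∈ Ω → y ∈ Ω → ∀ t : ℝ≥0, φ y t ≤ s →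
          φ x (β₂ * t) ≤ φ y t + h x + h y

/-- The weighted modular `ρ_φ^ω(g) = ∫_Ω φ(x, g(x)) ω(x) dx` (applied to `g = |f|`). -/
def wModular {n : ℕ} (Ω : Set (Rn n)) (ω : Rn n → ℝ≥0∞) (φ : Rn n → ℝ≥0∞ → ℝ≥0∞)
    (g : Rn n → ℝ≥0∞) : ℝ≥0∞ := ∫⁻ x in Ω, φ x (g x) * ω x

/-- The weighted Luxemburg norm `‖f‖_{L^φ(Ω,ω)}` (applied to `g = |f|`). -/
def wNorm {n : ℕ} (Ω : Set (Rn n)) (ω : Rn n → ℝ≥0∞) (φ : Rn n → ℝ≥0∞ → ℝ≥0∞)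
    (g : Rn n → ℝ≥0∞) : ℝ≥0∞ :=
  ⨅ (lam : ℝ≥0) (_ : 0 < lam)
    (_ : wModular Ω ω φ (fun x => g x / lam) ≤ 1), (lam : ℝ≥0∞)

/-- Membership in the weighted generalized Orlicz space `L^φ(Ω,ω)` (applied to `g = |f|`). -/
def MemLw {n : ℕ} (Ω : Set (Rn n)) (ω : Rn n → ℝ≥0∞) (φ : Rn n → ℝ≥0∞ → ℝ≥0∞)
    (g : Rn n → ℝ≥0∞) : Prop :=
  ∃ lam : ℝ≥0, 0 < lam ∧ wModular Ω ω φ (fun x => g x / lam) ≤ 1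

/-- The Hardy–Littlewood maximal operator (relative to `Ω`), applied to `g = |f|`. -/
def maximal {n : ℕ} (Ω : Set (Rn n)) (g : Rn n → ℝ≥0∞) (x : Rn n) : ℝ≥0∞ :=
  ⨆ (z : Rn n) (r : ℝ) (_ : 0 < r) (_ : x ∈ ball z r),
    (volume (ball z r))⁻¹ * ∫⁻ y in ball z r ∩ Ω, g y

/-- An `x`-independent weak Φ-function. -/
structure IsWeakPhi0 (ψ : ℝ≥0∞ → ℝ≥0∞) : Prop where
  mono : Monotone ψ
  map_zero : ψ 0 = 0
  tendsto_zero : Tendsto (fun t : ℝ≥0 => ψ t) (𝓝[>] 0) (𝓝 0)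
  tendsto_top : Tendsto (fun t : ℝ≥0 => ψ t) atTop (𝓝 ∞)
  aInc_one : ∃ a : ℝ≥0, 1 ≤ a ∧ ∀ s t : ℝ≥0, 0 < s → s < t →
    ψ s / (s : ℝ≥0∞) ≤ a * (ψ t / (t : ℝ≥0∞))

/-- The real-valued reciprocal `1/p(x)` of an exponent `p : Ω → [1,∞]` (with `1/∞ = 0`). -/
def invExp {n : ℕ} (p : Rn n → ℝ≥0∞) (x : Rn n) : ℝ := ((p x)⁻¹).toReal

/-- Local log-Hölder continuity of `g` on `Ω`. -/
def LocallyLogHolder {n : ℕ} (Ω : Set (Rn n)) (g : Rn n → ℝ) : Prop :=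
  ∃ c : ℝ, 0 < c ∧ ∀ x ∈ Ω, ∀ y ∈ Ω,
    |g x - g y| ≤ c / Real.log (Real.exp 1 + 1 / dist x y)

/-- The log-Hölder decay condition for `g` with limit `g∞`. -/
def LogHolderDecay {n : ℕ} (Ω : Set (Rn n)) (g : Rn n → ℝ) (ginf : ℝ) : Prop :=
  ∃ c : ℝ, 0 < c ∧ ∀ x ∈ Ω, |g x - ginf| ≤ c / Real.log (Real.exp 1 + ‖x‖)

/-- `1/p ∈ P^log(Ω)`: local log-Hölder continuity plus log-Hölder decay. -/
def PLog {n : ℕ} (Ω : Set (Rn n)) (p : Rn n → ℝ≥0∞) : Prop :=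
  LocallyLogHolder Ω (invExp p) ∧
    ∃ pinf : ℝ≥0∞, 1 ≤ pinf ∧ LogHolderDecay Ω (invExp p) ((pinf)⁻¹).toReal

/-- The variable exponent Φ-function `φ(x,t) = t^{p(x)}`, with
`t^∞ := ∞·χ_{(1,∞)}(t)`. -/
def varExp {n : ℕ} (p : Rn n → ℝ≥0∞) (x : Rn n) (t : ℝ≥0∞) : ℝ≥0∞ :=
  if p x = ∞ then (if t ≤ 1 then 0 else ∞) else t ^ (p x).toReal

/-- The double phase functional `φ(x,t) = t^p + a(x) t^q`. -/
def doublePhase {n : ℕ} (a : Rn n → ℝ) (p q : ℝ) (x : Rn n) (t : ℝ≥0∞) : ℝ≥0∞ :=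
  t ^ p + ENNReal.ofReal (a x) * t ^ q


namespace MaxOrlicz

lemma layer_fin (u : ℝ) (hu : 0 ≤ u) (r : ℝ) (hr : 0 < r) :
    (ENNReal.ofReal u) ^ r = ENNReal.ofReal r *
      ∫⁻ t in Ioi (0:ℝ), (if ENNReal.ofReal t < ENNReal.ofReal u
        then ENNReal.ofReal (t ^ (r - 1)) else 0) := by
  have h := lintegral_rpow_eq_lintegral_meas_lt_mul (μ := Measure.dirac ()) (f := fun _ : Unit => u)
    (Eventually.of_forall fun _ => hu) aemeasurable_const hr
  rw [lintegral_dirac] at h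
  rw [ENNReal.ofReal_rpow_of_nonneg hu hr.le, h]
  congr 1
  refine setLIntegral_congr_fun measurableSet_Ioi ?_
  intro t ht
  have ht' : (0:ℝ) < t := ht
  by_cases hlt : t < u
  · have : ENNReal.ofReal t < ENNReal.ofReal u := by
      rw [ENNReal.ofReal_lt_ofReal_iff (ht'.trans hlt)]; exact hlt
    simp [hlt, this]
  · have : ¬ ENNReal.ofReal t < ENNReal.ofReal u := by
      rw [not_lt]; exact ENNReal.ofReal_le_ofReal (not_lt.1 hlt)
    simp [hlt, this]

lemma layer (u : ℝ≥0∞) (r : ℝ) (hr : 0 < r) :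
    u ^ r = ENNReal.ofReal r *
      ∫⁻ t in Ioi (0:ℝ), (if ENNReal.ofReal t < u
        then ENNReal.ofReal (t ^ (r - 1)) else 0) := by
  by_cases hu : u = ∞
  · subst hu
    rw [ENNReal.top_rpow_of_pos hr]
    symm
    rw [eq_top_iff]
    refine ENNReal.le_of_forall_nnreal_lt fun N _ => ?_
    have h := layer_fin (((N:ℝ) ^ (1 / r))) (by positivity) r hr
    have e : (ENNReal.ofReal ((N:ℝ) ^ (1 / r))) ^ r = N := by
      rw [ENNReal.ofReal_rpow_of_nonneg (by positivity) hr.le, ← Real.rpow_mul (NNReal.coe_nonneg N),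
        one_div_mul_cancel hr.ne', Real.rpow_one]
      simp
    rw [← e, h]
    gcongr with t
    split_ifs with h1 h2
    · exact le_rfl
    · exact absurd ENNReal.ofReal_lt_top h2
    · exact zero_le
    · exact le_rfl
  · have := layer_fin u.toReal ENNReal.toReal_nonneg r hr
    rwa [ENNReal.ofReal_toReal hu] at this

/-- noncentered maximal function w.r.t. a measure -/
def mx {n : ℕ} (μ : Measure (Rn n)) (g : Rn n → ℝ≥0∞) (x : Rn n) : ℝ≥0∞ :=
  ⨆ (z : Rn n) (r : ℝ) (_ : 0 < r) (_ : x ∈ ball z r),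
    (μ (ball z r))⁻¹ * ∫⁻ y in ball z r, g y ∂μ

lemma lt_mx_iff {n : ℕ} {μ : Measure (Rn n)} {g : Rn n → ℝ≥0∞} {x : Rn n} {t : ℝ≥0∞} :
    t < mx μ g x ↔ ∃ (z : Rn n) (r : ℝ), 0 < r ∧ x ∈ ball z r ∧
      t < (μ (ball z r))⁻¹ * ∫⁻ y in ball z r, g y ∂μ := by
  simp only [mx, lt_iSup_iff, exists_prop]

lemma le_mx {n : ℕ} {μ : Measure (Rn n)} {g : Rn n → ℝ≥0∞} {x : Rn n} (z : Rn n) (r : ℝ)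
    (hr : 0 < r) (hx : x ∈ ball z r) :
    (μ (ball z r))⁻¹ * ∫⁻ y in ball z r, g y ∂μ ≤ mx μ g x := by
  unfold mx
  exact le_iSup_of_le z (le_iSup_of_le r (le_iSup_of_le hr (le_iSup_of_le hx le_rfl)))

lemma isOpen_mx {n : ℕ} (μ : Measure (Rn n)) (g : Rn n → ℝ≥0∞) (t : ℝ≥0∞) :
    IsOpen {x | t < mx μ g x} := by
  rw [isOpen_iff_mem_nhds]
  intro x hx
  obtain ⟨z, r, hr, hxz, h⟩ := lt_mx_iff.1 hx
  filter_upwards [isOpen_ball.mem_nhds hxz] with y hy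
  exact lt_mx_iff.2 ⟨z, r, hr, hy, h⟩

lemma measurable_mx {n : ℕ} (μ : Measure (Rn n)) (g : Rn n → ℝ≥0∞) : Measurable (mx μ g) :=
  measurable_of_Ioi fun t => (isOpen_mx μ g t).measurableSet

/-- doubling measures, positive and finite on balls -/
structure Dbl {n : ℕ} (μ : Measure (Rn n)) (D : ℝ≥0∞) : Prop where
  pos : ∀ z r, 0 < r → μ (ball z r) ≠ 0
  fin : ∀ z r, 0 < r → μ (ball z r) ≠ ∞
  dbl : ∀ z r, 0 < r → μ (ball z (5 * r)) ≤ D * μ (ball z r)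

lemma weak_R {n : ℕ} {μ : Measure (Rn n)} {D : ℝ≥0∞} (hμ : Dbl μ D) (g : Rn n → ℝ≥0∞)
    (t : ℝ≥0∞) (R : ℝ) :
    t * μ {x | ∃ (z : Rn n) (r : ℝ), 0 < r ∧ r ≤ R ∧ x ∈ ball z r ∧
      t < (μ (ball z r))⁻¹ * ∫⁻ y in ball z r, g y ∂μ} ≤ D * ∫⁻ y, g y ∂μ := by
  set S : Set (Rn n × ℝ) := {a | 0 < a.2 ∧ a.2 ≤ R ∧
    t < (μ (ball a.1 a.2))⁻¹ * ∫⁻ y in ball a.1 a.2, g y ∂μ} with hS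
  obtain ⟨u, huS, hud, hcov⟩ := Vitali.exists_disjoint_subfamily_covering_enlargement_closedBall
    S (fun a => a.1) (fun a => a.2) R (fun a ha => ha.2.1) 4 (by norm_num)
  have hdis : u.PairwiseDisjoint fun a => ball a.1 a.2 :=
    hud.mono fun a => ball_subset_closedBall
  have hcount : u.Countable := hdis.countable_of_isOpen (fun a _ => isOpen_ball)
    (fun a ha => ⟨a.1, mem_ball_self (huS ha).1⟩)
  have hsub : {x | ∃ (z : Rn n) (r : ℝ), 0 < r ∧ r ≤ R ∧ x ∈ ball z r ∧
      t < (μ (ball z r))⁻¹ * ∫⁻ y in ball z r, g y ∂μ} ⊆ ⋃ a ∈ u, ball a.1 (5 * a.2) := by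
    rintro x ⟨z, r, hr, hrR, hx, h⟩
    obtain ⟨b, hb, hsub⟩ := hcov (z, r) ⟨hr, hrR, h⟩
    have hbp := (huS hb).1
    refine mem_iUnion₂.2 ⟨b, hb, ?_⟩
    have := hsub (ball_subset_closedBall hx)
    exact closedBall_subset_ball (by linarith) this
  calc t * μ _ ≤ t * ∑' a : u, μ (ball a.1.1 (5 * a.1.2)) := by
        gcongr
        exact (measure_mono hsub).trans (measure_biUnion_le μ hcount _)
    _ ≤ t * ∑' a : u, D * μ (ball a.1.1 a.1.2) := by
        gcongr with a
        exact hμ.dbl _ _ (huS a.2).1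
    _ = D * ∑' a : u, t * μ (ball a.1.1 a.1.2) := by
        rw [ENNReal.tsum_mul_left, ENNReal.tsum_mul_left]; ring
    _ ≤ D * ∑' a : u, ∫⁻ y in ball a.1.1 a.1.2, g y ∂μ := by
        gcongr with a
        obtain ⟨h1, -, h3⟩ := huS a.2
        have h0 := hμ.pos a.1.1 a.1.2 h1
        have hT := hμ.fin a.1.1 a.1.2 h1
        calc t * μ (ball a.1.1 a.1.2) ≤ ((μ (ball a.1.1 a.1.2))⁻¹ *
              ∫⁻ y in ball a.1.1 a.1.2, g y ∂μ) * μ (ball a.1.1 a.1.2) := by gcongr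
          _ = ∫⁻ y in ball a.1.1 a.1.2, g y ∂μ := by
              rw [mul_comm, ← mul_assoc, ENNReal.mul_inv_cancel h0 hT, one_mul]
    _ = D * ∫⁻ y in ⋃ a ∈ u, ball a.1 a.2, g y ∂μ := by
        rw [lintegral_biUnion hcount (fun a _ => measurableSet_ball) hdis]
    _ ≤ D * ∫⁻ y, g y ∂μ := by
        exact mul_le_mul_right (setLIntegral_le_lintegral _ _) _

lemma weak {n : ℕ} {μ : Measure (Rn n)} {D : ℝ≥0∞} (hμ : Dbl μ D) (g : Rn n → ℝ≥0∞)
    (t : ℝ≥0∞) :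
    t * μ {x | t < mx μ g x} ≤ D * ∫⁻ y, g y ∂μ := by
  have : {x | t < mx μ g x} = ⋃ N : ℕ, {x | ∃ (z : Rn n) (r : ℝ), 0 < r ∧ r ≤ (N:ℝ) ∧
      x ∈ ball z r ∧ t < (μ (ball z r))⁻¹ * ∫⁻ y in ball z r, g y ∂μ} := by
    ext x
    simp only [mem_ofPred_eq, lt_mx_iff, mem_iUnion]
    constructor
    · rintro ⟨z, r, h1, h2, h3⟩
      obtain ⟨N, hN⟩ := exists_nat_ge r
      exact ⟨N, z, r, h1, hN, h2, h3⟩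
    · rintro ⟨N, z, r, h1, -, h2, h3⟩
      exact ⟨z, r, h1, h2, h3⟩
  rw [this, Monotone.measure_iUnion, ENNReal.mul_iSup]
  · exact iSup_le fun N => weak_R hμ g t N
  · intro N M hNM x
    rintro ⟨z, r, h1, h2, h3⟩
    exact ⟨z, r, h1, h2.trans (by exact_mod_cast hNM), h3⟩

lemma weak2 {n : ℕ} {μ : Measure (Rn n)} {D : ℝ≥0∞} (hμ : Dbl μ D) (g : Rn n → ℝ≥0∞)
    (t : ℝ) (ht : 0 < t) :
    μ {x | ENNReal.ofReal t < mx μ g x} ≤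
      2 * D * (ENNReal.ofReal t)⁻¹ * ∫⁻ y, (if ENNReal.ofReal t < 2 * g y then g y else 0) ∂μ := by
  set T := ENNReal.ofReal t with hT
  have hT0 : T ≠ 0 := by simpa [hT] using ht
  have hTt : T ≠ ∞ := ENNReal.ofReal_ne_top
  set g1 : Rn n → ℝ≥0∞ := fun y => if T < 2 * g y then g y else 0 with hg1
  have hle : ∀ y, g y ≤ g1 y + T / 2 := by
    intro y
    simp only [hg1]
    split_ifs with h
    · exact le_self_add
    · rw [zero_add, ENNReal.le_div_iff_mul_le (by simp) (by simp), mul_comm]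
      exact not_lt.1 h
  have hsub : {x | T < mx μ g x} ⊆ {x | T / 2 < mx μ g1 x} := by
    intro x hx
    obtain ⟨z, r, hr, hxz, h⟩ := lt_mx_iff.1 hx
    refine lt_mx_iff.2 ⟨z, r, hr, hxz, ?_⟩
    by_contra hcon
    rw [not_lt] at hcon
    have : (μ (ball z r))⁻¹ * ∫⁻ y in ball z r, g y ∂μ ≤ T := by
      calc (μ (ball z r))⁻¹ * ∫⁻ y in ball z r, g y ∂μ
          ≤ (μ (ball z r))⁻¹ * ∫⁻ y in ball z r, (g1 y + T / 2) ∂μ := by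
            gcongr with y; exact hle y
        _ = (μ (ball z r))⁻¹ * ∫⁻ y in ball z r, g1 y ∂μ + T / 2 := by
            rw [lintegral_add_right _ measurable_const, mul_add, setLIntegral_const,
              mul_comm (T / 2), ← mul_assoc,
              ENNReal.inv_mul_cancel (hμ.pos z r hr) (hμ.fin z r hr), one_mul]
        _ ≤ T / 2 + T / 2 := by gcongr
        _ = T := ENNReal.add_halves T
    exact absurd h (not_lt.2 this)
  have hw := weak hμ g1 (T / 2)
  have h2 : T / 2 * μ {x | T < mx μ g x} ≤ D * ∫⁻ y, g1 y ∂μ :=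
    le_trans (by gcongr) hw
  calc μ {x | T < mx μ g x} = 2 * T⁻¹ * (T / 2 * μ {x | T < mx μ g x}) := by
        rw [← mul_assoc, div_eq_mul_inv]
        have : 2 * T⁻¹ * (T * 2⁻¹) = (2 * 2⁻¹) * (T⁻¹ * T) := by ring
        rw [this, ENNReal.inv_mul_cancel hT0 hTt, ENNReal.mul_inv_cancel (by simp) (by simp)]
        simp
    _ ≤ 2 * T⁻¹ * (D * ∫⁻ y, g1 y ∂μ) := by gcongr
    _ = _ := by ring

lemma strong {n : ℕ} {μ : Measure (Rn n)} [SFinite μ] {D : ℝ≥0∞} (hμ : Dbl μ D)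
    (q : ℝ) (hq : 1 < q) (g : Rn n → ℝ≥0∞) (hg : Measurable g) :
    ∫⁻ x, (mx μ g x) ^ q ∂μ ≤
      ENNReal.ofReal q * (2 * D) * ((ENNReal.ofReal (q - 1))⁻¹ * 2 ^ (q - 1)) *
        ∫⁻ x, (g x) ^ q ∂μ := by
  have hq0 : 0 < q := by linarith
  have hm := measurable_mx μ g
  have meas_pow : ∀ s : ℝ, Measurable fun t : ℝ => ENNReal.ofReal (t ^ s) := fun s => by fun_prop
  calc ∫⁻ x, (mx μ g x) ^ q ∂μ
      = ∫⁻ x, (ENNReal.ofReal q * ∫⁻ t in Ioi (0:ℝ), (if ENNReal.ofReal t < mx μ g x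
        then ENNReal.ofReal (t ^ (q - 1)) else 0)) ∂μ := by
        congr 1; ext x; exact layer _ q hq0
    _ = ENNReal.ofReal q * ∫⁻ x, (∫⁻ t in Ioi (0:ℝ), (if ENNReal.ofReal t < mx μ g x
        then ENNReal.ofReal (t ^ (q - 1)) else 0)) ∂μ :=
        lintegral_const_mul' _ _ ENNReal.ofReal_ne_top
    _ = ENNReal.ofReal q * ∫⁻ t in Ioi (0:ℝ), ∫⁻ x, (if ENNReal.ofReal t < mx μ g x
        then ENNReal.ofReal (t ^ (q - 1)) else 0) ∂μ := by
        rw [lintegral_lintegral_swap]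
        refine Measurable.aemeasurable ?_
        refine Measurable.ite ?_ ((meas_pow _).comp measurable_snd) measurable_const
        exact measurableSet_lt (ENNReal.measurable_ofReal.comp measurable_snd)
          (hm.comp measurable_fst)
    _ ≤ ENNReal.ofReal q * ∫⁻ t in Ioi (0:ℝ), ∫⁻ x, (2 * D) *
          (g x * (if ENNReal.ofReal t < 2 * g x
            then ENNReal.ofReal (t ^ (q - 1 - 1)) else 0)) ∂μ := by
        gcongr ENNReal.ofReal q * ?_
        refine setLIntegral_mono' measurableSet_Ioi ?_
        intro t ht
        have ht' : (0:ℝ) < t := ht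
        have e1 : (fun x => (if ENNReal.ofReal t < mx μ g x
            then ENNReal.ofReal (t ^ (q - 1)) else 0)) =
            {x | ENNReal.ofReal t < mx μ g x}.indicator
              (fun _ => ENNReal.ofReal (t ^ (q - 1))) := by
          ext x; simp [indicator]
        rw [e1, lintegral_indicator_const (isOpen_mx μ g _).measurableSet]
        have e2 : ENNReal.ofReal (t ^ (q - 1)) * (ENNReal.ofReal t)⁻¹
            = ENNReal.ofReal (t ^ (q - 1 - 1)) := by
          rw [← ENNReal.ofReal_inv_of_pos ht', ← ENNReal.ofReal_mul (by positivity),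
            Real.rpow_sub_one ht'.ne' (q - 1), div_eq_mul_inv]
        calc ENNReal.ofReal (t ^ (q - 1)) * μ {x | ENNReal.ofReal t < mx μ g x}
            ≤ ENNReal.ofReal (t ^ (q - 1)) * (2 * D * (ENNReal.ofReal t)⁻¹ *
              ∫⁻ y, (if ENNReal.ofReal t < 2 * g y then g y else 0) ∂μ) := by
              gcongr; exact weak2 hμ g t ht'
          _ = 2 * D * (ENNReal.ofReal (t ^ (q - 1 - 1)) *
              ∫⁻ y, (if ENNReal.ofReal t < 2 * g y then g y else 0) ∂μ) := by
              rw [← e2]; ring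
          _ = ∫⁻ x, (2 * D) * (g x * (if ENNReal.ofReal t < 2 * g x
            then ENNReal.ofReal (t ^ (q - 1 - 1)) else 0)) ∂μ := by
              have hms : MeasurableSet {x | ENNReal.ofReal t < 2 * g x} :=
                measurableSet_lt measurable_const (hg.const_mul 2)
              rw [lintegral_const_mul, ← lintegral_const_mul']
              · congr 2; ext x; split_ifs <;> ring
              · exact ENNReal.ofReal_ne_top
              · exact hg.mul (Measurable.ite hms measurable_const measurable_const)
    _ = ENNReal.ofReal q * ∫⁻ x, (∫⁻ t in Ioi (0:ℝ), (2 * D) *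
          (g x * (if ENNReal.ofReal t < 2 * g x
            then ENNReal.ofReal (t ^ (q - 1 - 1)) else 0))) ∂μ := by
        rw [lintegral_lintegral_swap]
        refine Measurable.aemeasurable ?_
        refine Measurable.const_mul ?_ _
        refine (hg.comp measurable_snd).mul ?_
        refine Measurable.ite ?_ ((meas_pow _).comp measurable_fst) measurable_const
        exact measurableSet_lt (ENNReal.measurable_ofReal.comp measurable_fst)
          ((hg.comp measurable_snd).const_mul 2)
    _ = ENNReal.ofReal q * ∫⁻ x, (2 * D) * ((ENNReal.ofReal (q - 1))⁻¹ * 2 ^ (q - 1)) *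
          (g x) ^ q ∂μ := by
        congr 2; ext x
        have hmt : Measurable fun t : ℝ => (if ENNReal.ofReal t < 2 * g x
            then ENNReal.ofReal (t ^ (q - 1 - 1)) else 0) := by
          refine Measurable.ite ?_ (meas_pow _) measurable_const
          exact measurableSet_lt ENNReal.measurable_ofReal measurable_const
        rw [lintegral_const_mul _ (hmt.const_mul _), lintegral_const_mul _ hmt]
        have hl := layer (2 * g x) (q - 1) (by linarith)
        have hI : ∫⁻ t in Ioi (0:ℝ), (if ENNReal.ofReal t < 2 * g x
            then ENNReal.ofReal (t ^ (q - 1 - 1)) else 0) =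
            (ENNReal.ofReal (q - 1))⁻¹ * (2 * g x) ^ (q - 1) := by
          rw [hl, ← mul_assoc, ENNReal.inv_mul_cancel _ ENNReal.ofReal_ne_top, one_mul]
          simpa using hq
        rw [hI, ENNReal.mul_rpow_of_nonneg _ _ (by linarith : 0 ≤ q - 1)]
        have e3 : g x ^ q = g x * g x ^ (q - 1) := by
          conv_lhs => rw [show q = 1 + (q - 1) by ring]
          rw [ENNReal.rpow_add_of_nonneg _ _ (by norm_num) (by linarith), ENNReal.rpow_one]
        rw [e3]; ring
    _ = _ := by
        rw [lintegral_const_mul _ (hg.pow_const _)]; ring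

end MaxOrlicz

namespace MaxOrlicz

/-- A symmetric form of the Muckenhoupt condition for the pair `(ω, σ)`. -/
structure MPair {n : ℕ} (p q : ℝ) (ω σ : Rn n → ℝ≥0∞) (K : ℝ≥0∞) : Prop where
  conj : p.HolderConjugate q
  mω : Measurable ω
  mσ : Measurable σ
  pω : ∀ᵐ x ∂(volume : Measure (Rn n)), ω x ≠ 0 ∧ ω x ≠ ∞
  pσ : ∀ᵐ x ∂(volume : Measure (Rn n)), σ x ≠ 0 ∧ σ x ≠ ∞
  one : ∀ᵐ x ∂(volume : Measure (Rn n)), ω x ^ (1 / p) * σ x ^ (1 / q) = 1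
  e1 : ∀ᵐ x ∂(volume : Measure (Rn n)), ((ω x)⁻¹) ^ q * ω x = σ x
  e2 : ∀ᵐ x ∂(volume : Measure (Rn n)), ((σ x)⁻¹) ^ p * σ x = ω x
  fω : ∀ z r, 0 < r → wSet ω (ball z r) ≠ ∞
  fσ : ∀ z r, 0 < r → wSet σ (ball z r) ≠ ∞
  kfin : K ≠ ∞
  bd : ∀ z r, 0 < r → (wSet ω (ball z r)) ^ (1 / p) * (wSet σ (ball z r)) ^ (1 / q) ≤
    K * volume (ball z r)

lemma MPair.symm {n : ℕ} {p q : ℝ} {ω σ : Rn n → ℝ≥0∞} {K : ℝ≥0∞} (h : MPair p q ω σ K) :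
    MPair q p σ ω K where
  conj := h.conj.symm
  mω := h.mσ
  mσ := h.mω
  pω := h.pσ
  pσ := h.pω
  one := by filter_upwards [h.one] with x hx; rw [mul_comm]; exact hx
  e1 := h.e2
  e2 := h.e1
  fω := h.fσ
  fσ := h.fω
  kfin := h.kfin
  bd := by intro z r hr; rw [mul_comm]; exact h.bd z r hr

lemma wSet_ball_ne_zero {n : ℕ} {ω : Rn n → ℝ≥0∞} (mω : Measurable ω)
    (pω : ∀ᵐ x ∂(volume : Measure (Rn n)), ω x ≠ 0 ∧ ω x ≠ ∞) (z : Rn n) (r : ℝ) (hr : 0 < r) :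
    wSet ω (ball z r) ≠ 0 := by
  intro h0
  rw [wSet, lintegral_eq_zero_iff mω] at h0
  have : ∀ᵐ x ∂(volume.restrict (ball z r) : Measure (Rn n)), False := by
    filter_upwards [h0, ae_restrict_of_ae pω] with x h1 h2
    exact h2.1 h1
  rw [eventually_false_iff_eq_bot, ae_eq_bot, Measure.restrict_eq_zero] at this
  exact (measure_ball_pos volume z hr).ne' this

section
variable {n : ℕ} {p q : ℝ} {ω σ : Rn n → ℝ≥0∞} {K : ℝ≥0∞}

lemma MPair.holder (h : MPair p q ω σ K) (g : Rn n → ℝ≥0∞) (hg : Measurable g) (E : Set (Rn n)) :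
    ∫⁻ y in E, g y ≤ (∫⁻ y in E, g y ^ p * ω y) ^ (1 / p) * (wSet σ E) ^ (1 / q) := by
  have hp := h.conj.pos
  have hq := h.conj.symm.pos
  have H := ENNReal.lintegral_mul_le_Lp_mul_Lq (volume.restrict E) h.conj
    (f := fun y => g y * ω y ^ (1 / p)) (g := fun y => σ y ^ (1 / q))
    (hg.mul (h.mω.pow_const _)).aemeasurable (h.mσ.pow_const _).aemeasurable
  have e1 : ∫⁻ y in E, g y = ∫⁻ y in E, ((fun y => g y * ω y ^ (1 / p)) * fun y => σ y ^ (1 / q)) y := by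
    refine lintegral_congr_ae ?_
    filter_upwards [ae_restrict_of_ae h.one] with y hy
    simp only [Pi.mul_apply]
    rw [mul_assoc, hy, mul_one]
  rw [e1]
  refine H.trans (le_of_eq ?_)
  congr 2
  · congr 1; ext y
    rw [ENNReal.mul_rpow_of_nonneg _ _ hp.le, ← ENNReal.rpow_mul, one_div_mul_cancel hp.ne',
      ENNReal.rpow_one]
  · unfold wSet
    congr 1; ext y
    rw [← ENNReal.rpow_mul, one_div_mul_cancel hq.ne', ENNReal.rpow_one]

lemma MPair.avg (h : MPair p q ω σ K) (g : Rn n → ℝ≥0∞) (hg : Measurable g) (z : Rn n) (r : ℝ)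
    (hr : 0 < r) :
    (wSet ω (ball z r)) ^ (1 / p) * ((volume (ball z r))⁻¹ * ∫⁻ y in ball z r, g y) ≤
      K * (∫⁻ y in ball z r, g y ^ p * ω y) ^ (1 / p) := by
  have h0 : volume (ball z r) ≠ 0 := (measure_ball_pos volume z hr).ne'
  have hT : volume (ball z r) ≠ ∞ := measure_ball_lt_top.ne
  calc (wSet ω (ball z r)) ^ (1 / p) * ((volume (ball z r))⁻¹ * ∫⁻ y in ball z r, g y)
      ≤ (wSet ω (ball z r)) ^ (1 / p) * ((volume (ball z r))⁻¹ *
        ((∫⁻ y in ball z r, g y ^ p * ω y) ^ (1 / p) * (wSet σ (ball z r)) ^ (1 / q))) := by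
        gcongr; exact h.holder g hg _
    _ = (∫⁻ y in ball z r, g y ^ p * ω y) ^ (1 / p) * (volume (ball z r))⁻¹ *
        ((wSet ω (ball z r)) ^ (1 / p) * (wSet σ (ball z r)) ^ (1 / q)) := by ring
    _ ≤ (∫⁻ y in ball z r, g y ^ p * ω y) ^ (1 / p) * (volume (ball z r))⁻¹ *
        (K * volume (ball z r)) := by exact mul_le_mul_right (h.bd z r hr) _
    _ = K * (∫⁻ y in ball z r, g y ^ p * ω y) ^ (1 / p) *
        ((volume (ball z r))⁻¹ * volume (ball z r)) := by ring
    _ = _ := by rw [ENNReal.inv_mul_cancel h0 hT, mul_one]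

lemma vol_scale (z : Rn n) (r : ℝ) (s : ℝ) (hs : 0 < s) :
    volume (ball z (s * r)) = ENNReal.ofReal (s ^ n) * volume (ball z r) := by
  have := Measure.addHaar_ball_mul_of_pos (volume : Measure (Rn n)) z hs r
  rw [this, Measure.addHaar_ball_center volume z r]
  simp

lemma MPair.dbl (h : MPair p q ω σ K) :
    Dbl (volume.withDensity ω) ((K * ENNReal.ofReal (5 ^ n)) ^ p) := by
  have hp := h.conj.pos
  have e : ∀ z r, (volume.withDensity ω) (ball z r) = wSet ω (ball z r) := fun z r =>
    withDensity_apply _ measurableSet_ball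
  refine ⟨fun z r hr => ?_, fun z r hr => ?_, fun z r hr => ?_⟩
  · rw [e]; exact wSet_ball_ne_zero h.mω h.pω z r hr
  · rw [e]; exact h.fω z r hr
  · rw [e, e]
    have h5 : 0 < 5 * r := by linarith
    have H := h.avg ((ball z r).indicator 1) (measurable_one.indicator measurableSet_ball) z (5 * r) h5
    have hss : ball z r ⊆ ball z (5 * r) := ball_subset_ball (by linarith)
    have e1 : ∫⁻ y in ball z (5 * r), (ball z r).indicator 1 y = volume (ball z r) := by
      rw [lintegral_indicator_one measurableSet_ball, Measure.restrict_apply measurableSet_ball,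
        inter_eq_left.2 hss]
    have e2 : ∫⁻ y in ball z (5 * r), (ball z r).indicator 1 y ^ p * ω y = wSet ω (ball z r) := by
      have : ∀ y, (ball z r).indicator (1 : Rn n → ℝ≥0∞) y ^ p * ω y
          = (ball z r).indicator ω y := by
        intro y
        by_cases hy : y ∈ ball z r
        · simp only [indicator_of_mem hy]; simp
        · simp only [indicator_of_notMem hy]; simp [hp]
      simp_rw [this]
      rw [lintegral_indicator measurableSet_ball, Measure.restrict_restrict measurableSet_ball,
        inter_eq_left.2 hss, wSet]
    rw [e1, e2, vol_scale z r 5 (by norm_num)] at H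
    have h0 : volume (ball z r) ≠ 0 := (measure_ball_pos volume z hr).ne'
    have hT : volume (ball z r) ≠ ∞ := measure_ball_lt_top.ne
    set c := ENNReal.ofReal (5 ^ n) with hc
    have hc0 : c ≠ 0 := by simp [hc]
    have hcT : c ≠ ∞ := ENNReal.ofReal_ne_top
    rw [ENNReal.mul_inv (Or.inl hc0) (Or.inl hcT), mul_assoc c⁻¹, ENNReal.inv_mul_cancel h0 hT,
      mul_one] at H
    have H2 : (wSet ω (ball z (5 * r))) ^ (1 / p) ≤ K * c * (wSet ω (ball z r)) ^ (1 / p) := by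
      calc (wSet ω (ball z (5 * r))) ^ (1 / p) = (wSet ω (ball z (5 * r))) ^ (1 / p) * c⁻¹ * c := by
            rw [mul_assoc, ENNReal.inv_mul_cancel hc0 hcT, mul_one]
        _ ≤ K * wSet ω (ball z r) ^ (1 / p) * c := by gcongr
        _ = _ := by ring
    have H3 := ENNReal.rpow_le_rpow H2 hp.le
    rwa [ENNReal.mul_rpow_of_nonneg _ _ hp.le, ← ENNReal.rpow_mul, ← ENNReal.rpow_mul,
      one_div_mul_cancel hp.ne', ENNReal.rpow_one, ENNReal.rpow_one] at H3

lemma MPair.lerner (h : MPair p q ω σ K) (g : Rn n → ℝ≥0∞) (hg : Measurable g) (x : Rn n) :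
    (mx volume g x) ^ p ≤ (K ^ p * mx (volume.withDensity ω) (fun y =>
      (mx (volume.withDensity σ) (fun y => g y * (σ y)⁻¹) y) ^ (p - 1) * (ω y)⁻¹) x) ^ q := by
  have hp := h.conj.pos
  have hp1 : 0 < p - 1 := by linarith [h.conj.lt]
  have hpq : p = (p - 1) * q := h.conj.sub_one_mul_conj.symm
  set u : Rn n → ℝ≥0∞ := fun y => g y * (σ y)⁻¹ with hu
  set v : Rn n → ℝ≥0∞ := fun y => (mx (volume.withDensity σ) u y) ^ (p - 1) * (ω y)⁻¹ with hv
  have mu : Measurable u := hg.mul h.mσ.inv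
  have mv : Measurable v := ((measurable_mx _ _).pow_const _).mul h.mω.inv
  suffices hs : mx volume g x ≤ (K ^ p * mx (volume.withDensity ω) v x) ^ (1 / (p - 1)) by
    have := ENNReal.rpow_le_rpow hs hp.le
    rw [← ENNReal.rpow_mul] at this
    have e : 1 / (p - 1) * p = q := by
      rw [one_div, inv_mul_eq_iff_eq_mul₀ hp1.ne']; exact hpq
    rwa [e] at this
  refine iSup_le fun z => iSup_le fun r => iSup_le fun hr => iSup_le fun hx => ?_
  rw [one_div, ENNReal.le_rpow_inv_iff hp1]
  have h0 : volume (ball z r) ≠ 0 := (measure_ball_pos volume z hr).ne'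
  have hT : volume (ball z r) ≠ ∞ := measure_ball_lt_top.ne
  set V := volume (ball z r) with hV
  set I := ∫⁻ y in ball z r, g y with hI
  have s0 := wSet_ball_ne_zero h.mσ h.pσ z r hr
  have sT := h.fσ z r hr
  have w0 := wSet_ball_ne_zero h.mω h.pω z r hr
  have wT := h.fω z r hr
  set S := wSet σ (ball z r) with hS
  set W := wSet ω (ball z r) with hW
  have eS : (volume.withDensity σ) (ball z r) = S := withDensity_apply _ measurableSet_ball
  have eW : (volume.withDensity ω) (ball z r) = W := withDensity_apply _ measurableSet_ball
  have a1 : ∀ y ∈ ball z r, S⁻¹ * I ≤ mx (volume.withDensity σ) u y := by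
    intro y hy
    have := le_mx (μ := volume.withDensity σ) (g := u) z r hr hy
    rw [eS, setLIntegral_withDensity_eq_setLIntegral_mul _ h.mσ mu measurableSet_ball] at this
    refine le_trans (le_of_eq ?_) this
    rw [hI]
    congr 1
    refine lintegral_congr_ae ?_
    filter_upwards [ae_restrict_of_ae h.pσ] with y hy
    simp only [Pi.mul_apply, hu]
    rw [mul_comm, mul_assoc, ENNReal.inv_mul_cancel hy.1 hy.2, mul_one]
  have a2 : V * (S⁻¹ * I) ^ (p - 1) ≤ W * mx (volume.withDensity ω) v x := by
    calc V * (S⁻¹ * I) ^ (p - 1) = ∫⁻ y in ball z r, (S⁻¹ * I) ^ (p - 1) := by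
          rw [setLIntegral_const, mul_comm]
      _ ≤ ∫⁻ y in ball z r, (ω * v) y := by
          refine lintegral_mono_ae ?_
          filter_upwards [ae_restrict_of_ae h.pω, ae_restrict_mem measurableSet_ball] with y h1 h2
          simp only [Pi.mul_apply, hv]
          rw [mul_comm (ω y), mul_assoc, ENNReal.inv_mul_cancel h1.1 h1.2, mul_one]
          exact ENNReal.rpow_le_rpow (a1 y h2) hp1.le
      _ = W * (W⁻¹ * ∫⁻ y in ball z r, v y ∂(volume.withDensity ω)) := by
          rw [← mul_assoc, ENNReal.mul_inv_cancel w0 wT, one_mul,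
            setLIntegral_withDensity_eq_setLIntegral_mul _ h.mω mv measurableSet_ball]
      _ ≤ _ := by
          gcongr
          have := le_mx (μ := volume.withDensity ω) (g := v) z r hr hx
          rwa [eW] at this
  have a3 : W * S ^ (p - 1) ≤ K ^ p * V ^ p := by
    have := ENNReal.rpow_le_rpow (h.bd z r hr) hp.le
    rw [ENNReal.mul_rpow_of_nonneg _ _ hp.le, ENNReal.mul_rpow_of_nonneg _ _ hp.le,
      ← ENNReal.rpow_mul, ← ENNReal.rpow_mul, one_div_mul_cancel hp.ne', ENNReal.rpow_one] at this
    have e : 1 / q * p = p - 1 := by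
      rw [one_div, inv_mul_eq_iff_eq_mul₀ h.conj.symm.pos.ne', mul_comm]; exact hpq
    rwa [e] at this
  have eV : V ^ p = V * V ^ (p - 1) := by
    conv_lhs => rw [show p = 1 + (p - 1) by ring]
    rw [ENNReal.rpow_add_of_nonneg _ _ (by norm_num) (by linarith), ENNReal.rpow_one]
  have eI : S ^ (p - 1) * (S⁻¹ * I) ^ (p - 1) = I ^ (p - 1) := by
    rw [← ENNReal.mul_rpow_of_nonneg _ _ hp1.le, ← mul_assoc, ENNReal.mul_inv_cancel s0 sT, one_mul]
  have eVV : V⁻¹ ^ (p - 1) * V ^ (p - 1) = 1 := by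
    rw [← ENNReal.mul_rpow_of_nonneg _ _ hp1.le, ENNReal.inv_mul_cancel h0 hT, ENNReal.one_rpow]
  have a4 : V * I ^ (p - 1) ≤ V * (K ^ p * V ^ (p - 1) * mx (volume.withDensity ω) v x) := by
    calc V * I ^ (p - 1) = S ^ (p - 1) * (V * (S⁻¹ * I) ^ (p - 1)) := by rw [← eI]; ring
      _ ≤ S ^ (p - 1) * (W * mx (volume.withDensity ω) v x) := by gcongr
      _ = (W * S ^ (p - 1)) * mx (volume.withDensity ω) v x := by ring
      _ ≤ (K ^ p * V ^ p) * mx (volume.withDensity ω) v x := by gcongr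
      _ = _ := by rw [eV]; ring
  have a5 := (ENNReal.mul_le_mul_iff_right h0 hT).1 a4
  calc (V⁻¹ * I) ^ (p - 1) = V⁻¹ ^ (p - 1) * I ^ (p - 1) := ENNReal.mul_rpow_of_nonneg _ _ hp1.le
    _ ≤ V⁻¹ ^ (p - 1) * (K ^ p * V ^ (p - 1) * mx (volume.withDensity ω) v x) := by gcongr
    _ = (V⁻¹ ^ (p - 1) * V ^ (p - 1)) * (K ^ p * mx (volume.withDensity ω) v x) := by ring
    _ = _ := by rw [eVV, one_mul]

lemma const_fin (q : ℝ) (hq : 1 < q) (D : ℝ≥0∞) (hD : D ≠ ∞) :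
    ENNReal.ofReal q * (2 * D) * ((ENNReal.ofReal (q - 1))⁻¹ * 2 ^ (q - 1)) ≠ ∞ := by
  refine ENNReal.mul_ne_top (ENNReal.mul_ne_top ENNReal.ofReal_ne_top
    (ENNReal.mul_ne_top (by simp) hD)) (ENNReal.mul_ne_top ?_ ?_)
  · rw [ENNReal.inv_ne_top]; simpa using hq
  · exact ENNReal.rpow_ne_top_of_nonneg (by linarith) (by simp)

/-- Muckenhoupt's theorem, after Lerner. -/
lemma MPair.muckenhoupt (h : MPair p q ω σ K) :
    ∃ C : ℝ≥0∞, C ≠ ∞ ∧ ∀ g : Rn n → ℝ≥0∞, Measurable g →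
      ∫⁻ x, (mx volume g x) ^ p * ω x ≤ C * ∫⁻ x, g x ^ p * ω x := by
  have hp := h.conj.pos
  have hq := h.conj.symm.pos
  have hpq : p = (p - 1) * q := h.conj.sub_one_mul_conj.symm
  have Dfin : ∀ s : ℝ, 0 < s → (K * ENNReal.ofReal (5 ^ n)) ^ s ≠ ∞ := fun s hs =>
    ENNReal.rpow_ne_top_of_nonneg hs.le (ENNReal.mul_ne_top h.kfin ENNReal.ofReal_ne_top)
  refine ⟨(K ^ p) ^ q * ((ENNReal.ofReal q * (2 * (K * ENNReal.ofReal (5 ^ n)) ^ p) *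
    ((ENNReal.ofReal (q - 1))⁻¹ * 2 ^ (q - 1))) *
    (ENNReal.ofReal p * (2 * (K * ENNReal.ofReal (5 ^ n)) ^ q) *
    ((ENNReal.ofReal (p - 1))⁻¹ * 2 ^ (p - 1)))), ?_, ?_⟩
  · refine ENNReal.mul_ne_top ?_ (ENNReal.mul_ne_top ?_ ?_)
    · exact ENNReal.rpow_ne_top_of_nonneg hq.le (ENNReal.rpow_ne_top_of_nonneg hp.le h.kfin)
    · exact const_fin q h.conj.symm.lt _ (Dfin p hp)
    · exact const_fin p h.conj.lt _ (Dfin q hq)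
  intro g hg
  set u : Rn n → ℝ≥0∞ := fun y => g y * (σ y)⁻¹ with hu
  set v : Rn n → ℝ≥0∞ := fun y => (mx (volume.withDensity σ) u y) ^ (p - 1) * (ω y)⁻¹ with hv
  have mu : Measurable u := hg.mul h.mσ.inv
  have mv : Measurable v := ((measurable_mx _ _).pow_const _).mul h.mω.inv
  have wd : ∀ (f w : Rn n → ℝ≥0∞), Measurable f → Measurable w →
      ∫⁻ x, f x ∂(volume.withDensity w) = ∫⁻ x, f x * w x := by
    intro f w hf hw
    rw [lintegral_withDensity_eq_lintegral_mul _ hw hf]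
    congr 1; ext x; simp [mul_comm]
  have s1 := strong h.dbl q h.conj.symm.lt v mv
  have s2 := strong h.symm.dbl p h.conj.lt u mu
  rw [wd _ _ ((measurable_mx _ _).pow_const _) h.mω, wd _ _ (mv.pow_const _) h.mω] at s1
  rw [wd _ _ ((measurable_mx _ _).pow_const _) h.mσ, wd _ _ (mu.pow_const _) h.mσ] at s2
  set C1 := ENNReal.ofReal q * (2 * (K * ENNReal.ofReal (5 ^ n)) ^ p) *
    ((ENNReal.ofReal (q - 1))⁻¹ * 2 ^ (q - 1))
  set C2 := ENNReal.ofReal p * (2 * (K * ENNReal.ofReal (5 ^ n)) ^ q) *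
    ((ENNReal.ofReal (p - 1))⁻¹ * 2 ^ (p - 1))
  calc ∫⁻ x, (mx volume g x) ^ p * ω x
      ≤ ∫⁻ x, (K ^ p) ^ q * ((mx (volume.withDensity ω) v x) ^ q * ω x) := by
        refine lintegral_mono fun x => ?_
        rw [← mul_assoc, ← ENNReal.mul_rpow_of_nonneg _ _ hq.le]
        exact mul_le_mul_left (h.lerner g hg x) _
    _ = (K ^ p) ^ q * ∫⁻ x, ((mx (volume.withDensity ω) v x) ^ q * ω x) :=
        lintegral_const_mul _ (((measurable_mx _ _).pow_const _).mul h.mω)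
    _ ≤ (K ^ p) ^ q * (C1 * ∫⁻ x, v x ^ q * ω x) := by gcongr
    _ = (K ^ p) ^ q * (C1 * ∫⁻ x, (mx (volume.withDensity σ) u x) ^ p * σ x) := by
        congr 2
        refine lintegral_congr_ae ?_
        filter_upwards [h.e1] with x hx
        simp only [hv]
        rw [ENNReal.mul_rpow_of_nonneg _ _ hq.le, ← ENNReal.rpow_mul, ← hpq, mul_assoc, hx]
    _ ≤ (K ^ p) ^ q * (C1 * (C2 * ∫⁻ x, u x ^ p * σ x)) := by gcongr
    _ = (K ^ p) ^ q * (C1 * (C2 * ∫⁻ x, g x ^ p * ω x)) := by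
        congr 3
        refine lintegral_congr_ae ?_
        filter_upwards [h.e2] with x hx
        simp only [hu]
        rw [ENNReal.mul_rpow_of_nonneg _ _ hp.le, mul_assoc, hx]
    _ = _ := by ring

end

lemma mpair_of_Ap {n : ℕ} {p : ℝ} (hp1 : 1 < p) {ω : Rn n → ℝ≥0∞} (hω : MuckenhouptAq p ω) :
    ∃ (q : ℝ) (σ : Rn n → ℝ≥0∞) (K : ℝ≥0∞), MPair p q ω σ K := by
  obtain ⟨⟨mω, pω, fω⟩, C, hC, hbd⟩ := hω
  have hp0 : 0 < p := by linarith
  have hpm : 0 < p - 1 := by linarith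
  have hconj : p.HolderConjugate p.conjExponent := Real.HolderConjugate.conjExponent hp1
  set q := p.conjExponent with hq
  have hq' : q = p / (p - 1) := rfl
  have hq0 := hconj.symm.pos
  set σ : Rn n → ℝ≥0∞ := fun y => (ω y) ^ (-(1 / (p - 1))) with hσ
  have pω' : ∀ᵐ x ∂(volume : Measure (Rn n)), ω x ≠ 0 ∧ ω x ≠ ∞ := by
    filter_upwards [pω] with x hx; exact ⟨hx.1.ne', hx.2.ne⟩
  have fσ : ∀ z r, 0 < r → wSet σ (ball z r) ≠ ∞ := by
    intro z r hr htop
    have := hbd z r hr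
    change _ * _ * (wSet σ (ball z r)) ^ (p - 1) ≤ C at this
    rw [htop, ENNReal.top_rpow_of_pos hpm, ENNReal.mul_top] at this
    · exact hC (top_le_iff.1 this)
    · refine mul_ne_zero ?_ (wSet_ball_ne_zero mω pω' z r hr)
      rw [Ne, ENNReal.rpow_eq_zero_iff]
      have h0 : volume (ball z r) ≠ 0 := (measure_ball_pos volume z hr).ne'
      have hT : volume (ball z r) ≠ ∞ := measure_ball_lt_top.ne
      simp [h0, hT]
  refine ⟨q, σ, C ^ (1 / p), ⟨hconj, mω, mω.pow_const _, pω', ?_, ?_, ?_, ?_, fω, fσ, ?_, ?_⟩⟩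
  · filter_upwards [pω'] with x hx
    refine ⟨?_, ?_⟩
    · exact (ENNReal.rpow_pos (pos_iff_ne_zero.2 hx.1) hx.2).ne'
    · exact ENNReal.rpow_ne_top_of_ne_zero hx.1 hx.2
  · filter_upwards [pω'] with x hx
    simp only [hσ]
    rw [← ENNReal.rpow_mul, ← ENNReal.rpow_add _ _ hx.1 hx.2]
    have : 1 / p + -(1 / (p - 1)) * (1 / q) = 0 := by
      rw [hq']; field_simp; ring
    rw [this, ENNReal.rpow_zero]
  · filter_upwards [pω'] with x hx
    simp only [hσ]
    rw [← ENNReal.rpow_neg_one, ← ENNReal.rpow_mul]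
    conv_lhs => rw [← ENNReal.rpow_one (ω x)]
    rw [← ENNReal.rpow_mul, ← ENNReal.rpow_add _ _ hx.1 hx.2]
    congr 1
    rw [hq']; field_simp; ring
  · filter_upwards [pω'] with x hx
    simp only [hσ]
    rw [← ENNReal.rpow_neg_one, ← ENNReal.rpow_mul, ← ENNReal.rpow_mul,
      ← ENNReal.rpow_add _ _ hx.1 hx.2]
    conv_rhs => rw [← ENNReal.rpow_one (ω x)]
    congr 1
    field_simp; ring
  · exact ENNReal.rpow_ne_top_of_nonneg (by positivity) hC
  · intro z r hr
    have h0 : volume (ball z r) ≠ 0 := (measure_ball_pos volume z hr).ne'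
    have hT : volume (ball z r) ≠ ∞ := measure_ball_lt_top.ne
    have := hbd z r hr
    change _ * _ * (wSet σ (ball z r)) ^ (p - 1) ≤ C at this
    have H := ENNReal.rpow_le_rpow this (by positivity : 0 ≤ 1 / p)
    rw [ENNReal.mul_rpow_of_nonneg _ _ (by positivity), ENNReal.mul_rpow_of_nonneg _ _ (by positivity),
      ← ENNReal.rpow_mul, ← ENNReal.rpow_mul] at H
    have e1 : -p * (1 / p) = -1 := by field_simp
    have e2 : (p - 1) * (1 / p) = 1 / q := by rw [hq']; field_simp
    rw [e1, e2, ENNReal.rpow_neg_one] at H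
    calc wSet ω (ball z r) ^ (1 / p) * wSet σ (ball z r) ^ (1 / q)
        = ((volume (ball z r))⁻¹ * wSet ω (ball z r) ^ (1 / p) * wSet σ (ball z r) ^ (1 / q)) *
          volume (ball z r) := by
          rw [mul_comm _ (volume (ball z r)), ← mul_assoc, ← mul_assoc,
            ENNReal.mul_inv_cancel h0 hT, one_mul]
      _ ≤ _ := by gcongr

end MaxOrlicz

namespace MaxOrlicz

structure Pt (ψ : ℝ≥0∞ → ℝ≥0∞) (b β : ℝ≥0) : Prop where
  mono : Monotone ψ
  zero : ψ 0 = 0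
  inc : ∀ s t : ℝ≥0, s ≤ t → ψ s * t ≤ b * ψ t * s
  lo : ψ β ≤ 1
  hi : 1 ≤ ψ ((β⁻¹ : ℝ≥0) : ℝ≥0∞)

lemma jensen {α : Type*} [MeasurableSpace α] {μ : Measure α} {V : ℝ≥0∞} (hV0 : V ≠ 0)
    (hVT : V ≠ ∞) (hμ : μ univ ≤ V) {ψ : ℝ≥0∞ → ℝ≥0∞} {b β : ℝ≥0} (hψ : Pt ψ b β)
    {f : α → ℝ≥0} (mf : Measurable f) {g : α → ℝ≥0∞} (c t : ℝ≥0) (hc : 0 < c)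
    (H : ∀ᵐ y ∂μ, ψ ((2 * c * f y : ℝ≥0) : ℝ≥0∞) ≤ g y)
    (hlt : (t : ℝ≥0∞) < V⁻¹ * ∫⁻ y, f y ∂μ) :
    ψ ((c * t : ℝ≥0) : ℝ≥0∞) ≤ b * (V⁻¹ * ∫⁻ y, g y ∂μ) := by
  rcases eq_or_ne t 0 with rfl | ht
  · simp [hψ.zero]
  refine ENNReal.le_of_forall_nnreal_lt fun D hD => ?_
  set J := V⁻¹ * ∫⁻ y, g y ∂μ with hJ
  have hpt : ∀ᵐ y ∂μ, ((2 * c * D : ℝ≥0) : ℝ≥0∞) * f y ≤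
      ((c * t * D : ℝ≥0) : ℝ≥0∞) + ((b * (c * t) : ℝ≥0) : ℝ≥0∞) * g y := by
    filter_upwards [H] with y hy
    rcases le_total (2 * c * f y) (c * t) with h | h
    · refine le_add_right ?_
      have : 2 * c * D * f y ≤ c * t * D := by
        calc 2 * c * D * f y = 2 * c * f y * D := by ring
          _ ≤ _ := by gcongr
      exact_mod_cast this
    · refine le_add_left ?_
      have := hψ.inc _ _ h
      calc ((2 * c * D : ℝ≥0) : ℝ≥0∞) * f y = D * ((2 * c * f y : ℝ≥0) : ℝ≥0∞) := by
            push_cast; ring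
        _ ≤ ψ ((c * t : ℝ≥0) : ℝ≥0∞) * ((2 * c * f y : ℝ≥0) : ℝ≥0∞) := by gcongr
        _ ≤ b * ψ ((2 * c * f y : ℝ≥0) : ℝ≥0∞) * ((c * t : ℝ≥0) : ℝ≥0∞) := this
        _ ≤ b * g y * ((c * t : ℝ≥0) : ℝ≥0∞) := by gcongr
        _ = _ := by push_cast; ring
  have hIneq : ((2 * c * D : ℝ≥0) : ℝ≥0∞) * ∫⁻ y, f y ∂μ ≤
      ((c * t * D : ℝ≥0) : ℝ≥0∞) * V + ((b * (c * t) : ℝ≥0) : ℝ≥0∞) * ∫⁻ y, g y ∂μ := by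
    rw [← lintegral_const_mul' _ _ ENNReal.coe_ne_top, ← lintegral_const_mul' _ _ ENNReal.coe_ne_top]
    refine (lintegral_mono_ae hpt).trans ?_
    rw [lintegral_add_left measurable_const, lintegral_const]
    gcongr
  have h2 : ((c * t * D : ℝ≥0) : ℝ≥0∞) + ((c * t * D : ℝ≥0) : ℝ≥0∞) ≤
      ((c * t * D : ℝ≥0) : ℝ≥0∞) + ((c * t : ℝ≥0) : ℝ≥0∞) * (b * J) := by
    calc ((c * t * D : ℝ≥0) : ℝ≥0∞) + ((c * t * D : ℝ≥0) : ℝ≥0∞)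
        = ((2 * c * D : ℝ≥0) : ℝ≥0∞) * t := by push_cast; ring
      _ ≤ ((2 * c * D : ℝ≥0) : ℝ≥0∞) * (V⁻¹ * ∫⁻ y, f y ∂μ) := by gcongr
      _ = V⁻¹ * (((2 * c * D : ℝ≥0) : ℝ≥0∞) * ∫⁻ y, f y ∂μ) := by ring
      _ ≤ V⁻¹ * (((c * t * D : ℝ≥0) : ℝ≥0∞) * V +
          ((b * (c * t) : ℝ≥0) : ℝ≥0∞) * ∫⁻ y, g y ∂μ) := by gcongr
      _ = ((c * t * D : ℝ≥0) : ℝ≥0∞) * (V⁻¹ * V) + ((c * t : ℝ≥0) : ℝ≥0∞) * (b * J) := by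
          rw [hJ]; push_cast; ring
      _ = _ := by rw [ENNReal.inv_mul_cancel hV0 hVT, mul_one]
  have h3 := (ENNReal.add_le_add_iff_left ENNReal.coe_ne_top).1 h2
  rw [ENNReal.coe_mul (c * t) D] at h3
  exact (ENNReal.mul_le_mul_iff_right (by simp [hc.ne', ht]) ENNReal.coe_ne_top).1 h3

lemma large {α : Type*} [MeasurableSpace α] {μ : Measure α} {V : ℝ≥0∞} (hV0 : V ≠ 0)
    (hVT : V ≠ ∞) (hμ : μ univ ≤ V) {ψx : ℝ≥0∞ → ℝ≥0∞} {b β β₁ κ : ℝ≥0} (hb : 1 ≤ b)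
    (hβ : 0 < β) (hβ₁ : 0 < β₁) (hβ₁' : β₁ ≤ 1) (hβ' : β ≤ 1) (hκ : 1 ≤ κ)
    (hψ : Pt ψx b β) {ψ : α → ℝ≥0∞ → ℝ≥0∞} (hψy : ∀ᵐ y ∂μ, Pt (ψ y) b β) {W : ℝ≥0∞}
    (hA1 : 1 ≤ W → ∀ᵐ y ∂μ, ∀ t : ℝ≥0, 1 ≤ ψ y t → ψ y t ≤ W → ψx (β₁ * t) ≤ ψ y t)
    {f : α → ℝ≥0} (mf : Measurable f) (hf : ∀ y, f y = 0 ∨ β⁻¹ ≤ f y)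
    {G : α → ℝ≥0∞} (hG : ∀ᵐ y ∂μ, ψ y (f y) ≤ G y)
    (hm : V⁻¹ * ∫⁻ y, G y ∂μ ≤ κ * W) (t : ℝ≥0) (hlt : (t : ℝ≥0∞) < V⁻¹ * ∫⁻ y, f y ∂μ) :
    ψx ((β₁ * β ^ 2 / (1 + b * κ) * t : ℝ≥0) : ℝ≥0∞) ≤ b * (V⁻¹ * ∫⁻ y, G y ∂μ) := by
  set m := V⁻¹ * ∫⁻ y, G y ∂μ with hmdef
  have hκ0 : (κ : ℝ≥0∞) ≠ 0 := by
    have : κ ≠ 0 := (lt_of_lt_of_le one_pos hκ).ne'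
    exact_mod_cast this
  have hb0 : 0 < b := lt_of_lt_of_le one_pos hb
  have hκp : 0 < κ := lt_of_lt_of_le one_pos hκ
  set m' := m / κ with hm'
  have hmm : m = κ * m' := by
    rw [hm', ENNReal.mul_div_cancel hκ0 ENNReal.coe_ne_top]
  have hm'W : m' ≤ W := by
    rw [hm', ENNReal.div_le_iff_le_mul (Or.inl hκ0) (Or.inl ENNReal.coe_ne_top), mul_comm]
    exact hm
  have hm'm : m' ≤ m := by
    rw [hmm]
    calc m' = 1 * m' := (one_mul _).symm
      _ ≤ _ := by gcongr; exact_mod_cast hκ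
  have hmb : m ≤ b * m := by
    calc m = 1 * m := (one_mul _).symm
      _ ≤ _ := by gcongr; exact_mod_cast hb
  set τ : ℝ≥0 := t / (1 + b * κ) with hτ
  have hτt : τ * (1 + b * κ) = t := by rw [hτ]; field_simp
  have hct : β₁ * β ^ 2 / (1 + b * κ) * t = β₁ * (β ^ 2 * τ) := by rw [hτ]; field_simp
  rw [hct]
  rcases le_or_gt 1 m' with h1 | h1
  · by_contra hcon
    rw [not_le] at hcon
    have hm'lt : m' < ψx ((β₁ * (β ^ 2 * τ) : ℝ≥0) : ℝ≥0∞) := (hm'm.trans hmb).trans_lt hcon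
    have hm'T : m' ≠ ∞ := (hm'lt.trans_le le_top).ne
    have hm'0 : m' ≠ 0 := (lt_of_lt_of_le one_pos h1).ne'
    have hββ : β < β₁ * (β ^ 2 * τ) := by
      by_contra hle
      rw [not_lt] at hle
      have : ψx ((β₁ * (β ^ 2 * τ) : ℝ≥0) : ℝ≥0∞) ≤ 1 :=
        (hψ.mono (by exact_mod_cast hle)).trans hψ.lo
      exact absurd (h1.trans_lt hm'lt) (not_lt.2 this)
    have hτβ : β⁻¹ ≤ τ := by
      have h5 : β₁ * (β ^ 2 * τ) ≤ 1 * (β ^ 2 * τ) := by gcongr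
      have h6 : β * 1 < β * (β * τ) := by
        calc β * 1 = β := mul_one _
          _ < β₁ * (β ^ 2 * τ) := hββ
          _ ≤ 1 * (β ^ 2 * τ) := h5
          _ = _ := by ring
      have h7 : 1 < β * τ := lt_of_mul_lt_mul_left h6 hβ.le
      rw [inv_le_iff_one_le_mul₀ hβ, mul_comm]
      exact h7.le
    have hbig : ψx ((β₁ * (β ^ 2 * τ) : ℝ≥0) : ℝ≥0∞) ≤ ψx (β₁ * τ) := by
      apply hψ.mono
      have : β₁ * (β ^ 2 * τ) ≤ β₁ * τ := by
        gcongr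
        calc β ^ 2 * τ ≤ 1 * τ := by gcongr; exact pow_le_one₀ hβ.le hβ'
          _ = τ := one_mul _
      exact_mod_cast this
    have hpt : ∀ᵐ y ∂μ, m' * f y ≤ τ * m' + ((b * τ : ℝ≥0) : ℝ≥0∞) * G y := by
      filter_upwards [hA1 (h1.trans hm'W), hψy, hG] with y hy hP hGy
      have h1y : 1 ≤ ψ y τ := hP.hi.trans (hP.mono (by exact_mod_cast hτβ))
      have hmy : m' ≤ ψ y τ := by
        by_contra hlt'
        rw [not_le] at hlt'
        have := hy τ h1y (hlt'.le.trans hm'W)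
        exact absurd (hm'lt.trans_le (hbig.trans this)) (not_lt.2 hlt'.le)
      rcases le_total (f y) τ with hle | hle
      · refine le_add_right ?_
        rw [mul_comm]; gcongr
      · refine le_add_left ?_
        calc m' * f y ≤ ψ y τ * f y := by gcongr
          _ ≤ b * ψ y (f y) * τ := hP.inc _ _ hle
          _ ≤ b * G y * τ := by gcongr
          _ = _ := by push_cast; ring
    have hIneq : m' * ∫⁻ y, f y ∂μ ≤ τ * m' * V + ((b * τ : ℝ≥0) : ℝ≥0∞) * ∫⁻ y, G y ∂μ := by
      rw [← lintegral_const_mul' _ _ hm'T, ← lintegral_const_mul' _ _ ENNReal.coe_ne_top]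
      refine (lintegral_mono_ae hpt).trans ?_
      rw [lintegral_add_left measurable_const, lintegral_const]
      gcongr
    have hfin : m' * (V⁻¹ * ∫⁻ y, f y ∂μ) ≤ m' * t := by
      calc m' * (V⁻¹ * ∫⁻ y, f y ∂μ) = V⁻¹ * (m' * ∫⁻ y, f y ∂μ) := by ring
        _ ≤ V⁻¹ * (τ * m' * V + ((b * τ : ℝ≥0) : ℝ≥0∞) * ∫⁻ y, G y ∂μ) := by gcongr
        _ = τ * m' * (V⁻¹ * V) + b * τ * m := by rw [hmdef]; push_cast; ring
        _ = τ * m' + b * τ * (κ * m') := by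
            rw [ENNReal.inv_mul_cancel hV0 hVT, mul_one, ← hmm]
        _ = m' * ((τ * (1 + b * κ) : ℝ≥0) : ℝ≥0∞) := by push_cast; ring
        _ = m' * t := by rw [hτt]
    have := (ENNReal.mul_le_mul_iff_right hm'0 hm'T).1 hfin
    exact absurd hlt (not_lt.2 this)
  · have hm'T : m' ≠ ∞ := (h1.trans_le le_top).ne
    obtain ⟨r, hr⟩ : ∃ r : ℝ≥0, (r : ℝ≥0∞) = m' := ⟨m'.toNNReal, ENNReal.coe_toNNReal hm'T⟩
    have hr1 : r ≤ 1 := by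
      rw [← hr] at h1; exact_mod_cast h1.le
    have hpt : ∀ᵐ y ∂μ, (f y : ℝ≥0∞) ≤ ((β⁻¹ * b : ℝ≥0) : ℝ≥0∞) * G y := by
      filter_upwards [hψy, hG] with y hP hGy
      rcases hf y with h0 | hle
      · simp [h0]
      · calc (f y : ℝ≥0∞) = 1 * f y := (one_mul _).symm
          _ ≤ ψ y ((β⁻¹ : ℝ≥0) : ℝ≥0∞) * f y := by gcongr; exact hP.hi
          _ ≤ b * ψ y (f y) * ((β⁻¹ : ℝ≥0) : ℝ≥0∞) := hP.inc _ _ hle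
          _ ≤ b * G y * ((β⁻¹ : ℝ≥0) : ℝ≥0∞) := by gcongr
          _ = _ := by rw [ENNReal.coe_mul]; ring
    have ht : (t : ℝ≥0∞) ≤ ((β⁻¹ * b * (κ * r) : ℝ≥0) : ℝ≥0∞) := by
      calc (t : ℝ≥0∞) ≤ V⁻¹ * ∫⁻ y, f y ∂μ := hlt.le
        _ ≤ V⁻¹ * ∫⁻ y, ((β⁻¹ * b : ℝ≥0) : ℝ≥0∞) * G y ∂μ := by
            exact mul_le_mul_right (lintegral_mono_ae hpt) _
        _ = ((β⁻¹ * b : ℝ≥0) : ℝ≥0∞) * m := by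
            rw [lintegral_const_mul' _ _ ENNReal.coe_ne_top, hmdef]; ring
        _ = _ := by rw [hmm, ← hr, ENNReal.coe_mul (β⁻¹ * b), ENNReal.coe_mul κ]
    have ht' : t ≤ β⁻¹ * b * (κ * r) := by exact_mod_cast ht
    have hle : β₁ * (β ^ 2 * τ) ≤ β * r := by
      have h8 : τ ≤ β⁻¹ * r := by
        rw [hτ, div_le_iff₀ (by positivity)]
        calc t ≤ β⁻¹ * b * (κ * r) := ht'
          _ = β⁻¹ * r * (b * κ) := by ring
          _ ≤ β⁻¹ * r * (1 + b * κ) := by gcongr; exact le_add_of_nonneg_left zero_le_one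
      calc β₁ * (β ^ 2 * τ) ≤ 1 * (β ^ 2 * (β⁻¹ * r)) := by gcongr
        _ = β * r := by field_simp
    have hbr : ψx ((β * r : ℝ≥0) : ℝ≥0∞) ≤ b * r := by
      have h9 := hψ.inc (β * r) β (by
        calc β * r ≤ β * 1 := by gcongr
          _ = β := mul_one _)
      have h10 : (β : ℝ≥0∞) * ψx ((β * r : ℝ≥0) : ℝ≥0∞) ≤ β * (b * r) := by
        calc (β : ℝ≥0∞) * ψx ((β * r : ℝ≥0) : ℝ≥0∞) = ψx ((β * r : ℝ≥0) : ℝ≥0∞) * β := mul_comm _ _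
          _ ≤ b * ψx β * ((β * r : ℝ≥0) : ℝ≥0∞) := h9
          _ ≤ b * 1 * ((β * r : ℝ≥0) : ℝ≥0∞) := by gcongr; exact hψ.lo
          _ = _ := by push_cast; ring
      exact (ENNReal.mul_le_mul_iff_right (by simpa using hβ.ne') ENNReal.coe_ne_top).1 h10
    calc ψx ((β₁ * (β ^ 2 * τ) : ℝ≥0) : ℝ≥0∞) ≤ ψx ((β * r : ℝ≥0) : ℝ≥0∞) :=
          hψ.mono (by exact_mod_cast hle)
      _ ≤ b * r := hbr
      _ ≤ b * m := by rw [hr]; gcongr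

lemma rational_ball {n : ℕ} (Ω : Set (Rn n)) (f : Rn n → ℝ≥0∞) (x : Rn n) (t : ℝ≥0∞)
    (ht : t < maximal Ω f x) : ∃ (i : ℕ) (q : ℚ), 0 < (q : ℝ) ∧
      x ∈ ball (TopologicalSpace.denseSeq (Rn n) i) (q : ℝ) ∧
      t < 2 ^ n * ((volume (ball (TopologicalSpace.denseSeq (Rn n) i) (q : ℝ)))⁻¹ *
        ∫⁻ y in ball (TopologicalSpace.denseSeq (Rn n) i) (q : ℝ) ∩ Ω, f y) := by
  simp only [maximal, lt_iSup_iff, exists_prop] at ht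
  obtain ⟨z, r, hr, hx, h⟩ := ht
  obtain ⟨i, hi⟩ := (TopologicalSpace.denseRange_denseSeq (Rn n)).exists_dist_lt z
    (by linarith : 0 < r / 4)
  obtain ⟨q, hq1, hq2⟩ := exists_rat_btwn (by linarith : 5 * r / 4 < 7 * r / 4)
  set d := TopologicalSpace.denseSeq (Rn n) i
  have hs1 : ball z r ⊆ ball d q := by
    intro y hy
    rw [mem_ball] at hy ⊢
    linarith [dist_triangle y z d]
  have hs2 : ball d q ⊆ ball z (2 * r) := by
    intro y hy
    rw [mem_ball] at hy ⊢
    linarith [dist_triangle y d z, dist_comm z d]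
  refine ⟨i, q, by linarith, hs1 hx, h.trans_le ?_⟩
  have hv : volume (ball d q) ≤ 2 ^ n * volume (ball z r) := by
    refine (measure_mono hs2).trans (le_of_eq ?_)
    rw [vol_scale z r 2 (by norm_num), ENNReal.ofReal_pow (by norm_num)]
    norm_num
  rw [← mul_assoc]
  gcongr
  calc (volume (ball z r))⁻¹ = 2 ^ n * (2 ^ n * volume (ball z r))⁻¹ := by
        rw [ENNReal.mul_inv (by simp) (by simp), ← mul_assoc,
          ENNReal.mul_inv_cancel (by simp) (by simp), one_mul]
    _ ≤ 2 ^ n * (volume (ball d q))⁻¹ := by gcongr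

end MaxOrlicz

namespace MaxOrlicz

lemma pt_of {φx : ℝ≥0∞ → ℝ≥0∞} {a β : ℝ≥0} {p : ℝ} (hp : 0 < p) (ha : 1 ≤ a)
    (hmono : Monotone φx) (hzero : φx 0 = 0)
    (hinc : ∀ s t : ℝ≥0, 0 < s → s < t →
      φx s / (s : ℝ≥0∞) ^ p ≤ a * (φx t / (t : ℝ≥0∞) ^ p))
    (hβ : 0 < β) (lo : φx β ≤ 1) (hi : 1 ≤ φx ((β : ℝ≥0∞)⁻¹)) :
    Pt (fun t => φx t ^ (1 / p)) (a ^ (1 / p)) β := by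
  have hp' : 0 < 1 / p := by positivity
  have hb : (1 : ℝ≥0) ≤ a ^ (1 / p) := NNReal.one_le_rpow ha hp'.le
  refine ⟨fun s t hst => ENNReal.rpow_le_rpow (hmono hst) hp'.le, by simp [hzero, hp], ?_, ?_, ?_⟩
  · intro s t hst
    rcases eq_or_ne s 0 with rfl | hs
    · simp [hzero, hp]
    rcases hst.eq_or_lt with rfl | hlt
    · gcongr
      calc φx s ^ (1 / p) = 1 * φx s ^ (1 / p) := (one_mul _).symm
        _ ≤ _ := by
          gcongr
          exact_mod_cast hb
    have hs0 : 0 < s := pos_iff_ne_zero.2 hs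
    have ht0 : 0 < t := hs0.trans hlt
    have h1 := hinc s t hs0 hlt
    have es0 : ((s : ℝ≥0∞) ^ p) ≠ 0 := by simp [hs, hp, hp.le]
    have esT : ((s : ℝ≥0∞) ^ p) ≠ ∞ := by simp [hp.le]
    have et0 : ((t : ℝ≥0∞) ^ p) ≠ 0 := by simp [ht0.ne', hp, hp.le]
    have etT : ((t : ℝ≥0∞) ^ p) ≠ ∞ := by simp [hp.le]
    have h2 : φx s * (t : ℝ≥0∞) ^ p ≤ a * φx t * (s : ℝ≥0∞) ^ p := by
      calc φx s * (t : ℝ≥0∞) ^ p = φx s / (s : ℝ≥0∞) ^ p * (s : ℝ≥0∞) ^ p * (t : ℝ≥0∞) ^ p := by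
            rw [ENNReal.div_mul_cancel es0 esT]
        _ ≤ a * (φx t / (t : ℝ≥0∞) ^ p) * (s : ℝ≥0∞) ^ p * (t : ℝ≥0∞) ^ p := by gcongr
        _ = a * (φx t / (t : ℝ≥0∞) ^ p * (t : ℝ≥0∞) ^ p) * (s : ℝ≥0∞) ^ p := by ring
        _ = _ := by rw [ENNReal.div_mul_cancel et0 etT]
    have h3 := ENNReal.rpow_le_rpow h2 hp'.le
    rw [ENNReal.mul_rpow_of_nonneg _ _ hp'.le, ENNReal.mul_rpow_of_nonneg _ _ hp'.le,
      ENNReal.mul_rpow_of_nonneg _ _ hp'.le, ← ENNReal.rpow_mul, ← ENNReal.rpow_mul,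
      mul_one_div_cancel hp.ne', ENNReal.rpow_one, ENNReal.rpow_one] at h3
    rwa [ENNReal.coe_rpow_of_nonneg _ hp'.le]
  · exact ENNReal.rpow_le_one lo hp'.le
  · rw [ENNReal.coe_inv hβ.ne']
    exact ENNReal.one_le_rpow hi hp'

lemma ball_key {α : Type*} [MeasurableSpace α] {μ : Measure α} {V : ℝ≥0∞} (hV0 : V ≠ 0)
    (hVT : V ≠ ∞) (hμ : μ univ ≤ V) {ψx : ℝ≥0∞ → ℝ≥0∞} {b β β₁ β₂ κ : ℝ≥0} (hb : 1 ≤ b)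
    (hβ : 0 < β) (hβ₁ : 0 < β₁) (hβ₁' : β₁ ≤ 1) (hβ₂ : 0 < β₂) (hβ' : β ≤ 1) (hκ : 1 ≤ κ)
    (hψ : Pt ψx b β) {ψ : α → ℝ≥0∞ → ℝ≥0∞} (hψy : ∀ᵐ y ∂μ, Pt (ψ y) b β) {W : ℝ≥0∞}
    (hA1 : 1 ≤ W → ∀ᵐ y ∂μ, ∀ t : ℝ≥0, 1 ≤ ψ y t → ψ y t ≤ W → ψx (β₁ * t) ≤ ψ y t)
    {f : α → ℝ≥0} (mf : Measurable f)
    {G : α → ℝ≥0∞} {H : ℝ≥0∞} (hG : ∀ᵐ y ∂μ, ψ y (f y) ≤ G y)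
    (hA2 : ∀ᵐ y ∂μ, ∀ t : ℝ≥0, ψ y t ≤ 1 → t ≤ f y → ψx (β₂ * t) ≤ G y + H)
    (hm : V⁻¹ * ∫⁻ y, G y ∂μ ≤ κ * W) (t : ℝ≥0) (hlt : (t : ℝ≥0∞) < V⁻¹ * ∫⁻ y, f y ∂μ) :
    ψx ((min (β₁ * β ^ 2 / (1 + b * κ)) (β₂ * β ^ 2 / 2) * (t / 2) : ℝ≥0) : ℝ≥0∞) ≤
      b * (V⁻¹ * ∫⁻ y, G y ∂μ + H) := by
  set f1 : α → ℝ≥0 := fun y => if β⁻¹ ≤ f y then f y else 0 with hf1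
  set f2 : α → ℝ≥0 := fun y => if β⁻¹ ≤ f y then 0 else f y with hf2
  have mS : MeasurableSet {y | β⁻¹ ≤ f y} := measurableSet_le measurable_const mf
  have m1 : Measurable f1 := Measurable.ite mS mf measurable_const
  have m2 : Measurable f2 := Measurable.ite mS measurable_const mf
  have hsum : ∫⁻ y, f y ∂μ = ∫⁻ y, f1 y ∂μ + ∫⁻ y, f2 y ∂μ := by
    rw [← lintegral_add_left m1.coe_nnreal_ennreal]
    congr 1; ext y
    simp only [hf1, hf2]; split_ifs <;> simp
  have hor : ((t / 2 : ℝ≥0) : ℝ≥0∞) < V⁻¹ * ∫⁻ y, f1 y ∂μ ∨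
      ((t / 2 : ℝ≥0) : ℝ≥0∞) < V⁻¹ * ∫⁻ y, f2 y ∂μ := by
    by_contra! hcon
    refine absurd hlt (not_lt.2 ?_)
    rw [hsum, mul_add]
    refine (add_le_add hcon.1 hcon.2).trans (le_of_eq ?_)
    rw [← ENNReal.coe_add, add_halves]
  rcases hor with h1 | h2
  · have := large hV0 hVT hμ hb hβ hβ₁ hβ₁' hβ' hκ hψ hψy hA1 m1
      (fun y => by simp only [hf1]; split_ifs with h; exacts [Or.inr h, Or.inl rfl])
      (G := G) (by
        filter_upwards [hG, hψy] with y hy hP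
        refine (hP.mono ?_).trans hy
        simp only [hf1]; split_ifs <;> simp) hm (t / 2) h1
    refine ((hψ.mono ?_).trans this).trans (by gcongr; exact le_self_add)
    exact_mod_cast mul_le_mul_left (min_le_left _ _) _
  · have := jensen hV0 hVT hμ hψ m2 (g := fun y => G y + H) (β₂ * β ^ 2 / 2) (t / 2)
      (by positivity) (by
        filter_upwards [hA2, hψy] with y hy hP
        have hle : β ^ 2 * f2 y ≤ β := by
          simp only [hf2]; split_ifs with h
          · simp
          · have : f y ≤ β⁻¹ := (not_le.1 h).le
            calc β ^ 2 * f y ≤ β ^ 2 * β⁻¹ := by gcongr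
              _ = β := by field_simp
        have hle2 : β ^ 2 * f2 y ≤ f y := by
          have : f2 y ≤ f y := by simp only [hf2]; split_ifs <;> simp
          calc β ^ 2 * f2 y ≤ 1 * f y := by
                gcongr
                exact pow_le_one₀ (by positivity) hβ'
            _ = f y := one_mul _
        have := hy (β ^ 2 * f2 y) ((hP.mono (by exact_mod_cast hle)).trans hP.lo) hle2
        convert this using 2
        rw [← ENNReal.coe_mul]
        congr 1
        field_simp) h2
    refine ((hψ.mono ?_).trans this).trans ?_
    · exact_mod_cast mul_le_mul_left (min_le_right _ _) _
    gcongr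
    rw [lintegral_add_right _ measurable_const, mul_add, lintegral_const]
    gcongr
    calc V⁻¹ * (H * μ univ) ≤ V⁻¹ * (H * V) := by gcongr
      _ = H * (V⁻¹ * V) := by ring
      _ = H := by rw [ENNReal.inv_mul_cancel hV0 hVT, mul_one]

end MaxOrlicz

namespace MaxOrlicz

lemma key {n : ℕ} {Ω : Set (Rn n)} (hΩ : MeasurableSet Ω) {φ : Rn n → ℝ≥0∞ → ℝ≥0∞}
    {ω : Rn n → ℝ≥0∞} {p : ℝ} (hp1 : 1 < p) (hφ : IsWeakPhi Ω φ)
    {b β β₁ β₂ κ : ℝ≥0} (hb : 1 ≤ b)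
    (hβ : 0 < β) (hβ₁ : 0 < β₁) (hβ₁' : β₁ ≤ 1) (hβ₂ : 0 < β₂) (hβ' : β ≤ 1) (hκ : 1 ≤ κ)
    (hPt : ∀ᵐ x ∂(volume : Measure (Rn n)), x ∈ Ω → Pt (fun t => φ x t ^ (1 / p)) b β)
    (hA1 : ∀ (z : Rn n) (r : ℝ), 0 < r → wSet ω (ball z r) ≤ 1 →
      ∀ᵐ x ∂(volume : Measure (Rn n)), ∀ᵐ y ∂(volume : Measure (Rn n)),
      x ∈ ball z r ∩ Ω → y ∈ ball z r ∩ Ω →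
        ∀ t : ℝ≥0, 1 ≤ φ y t → φ y t ≤ (wSet ω (ball z r))⁻¹ →
          φ x (β₁ * t) ≤ φ y t)
    {h : Rn n → ℝ≥0} (mh : Measurable h)
    (hA2 : ∀ᵐ x ∂(volume : Measure (Rn n)), ∀ᵐ y ∂(volume : Measure (Rn n)),
        x ∈ Ω → y ∈ Ω → ∀ t : ℝ≥0, φ y t ≤ (1 : ℝ≥0) →
          φ x (β₂ * t) ≤ φ y t + h x + h y)
    {q : ℝ} {σ : Rn n → ℝ≥0∞} {K : ℝ≥0∞} (hM : MPair p q ω σ K)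
    (hKκ : K * (1 + ∫⁻ x in Ω, (h x : ℝ≥0∞) * ω x) ^ (1 / p) ≤ κ)
    {f : Rn n → ℝ≥0} (mf : Measurable f)
    (hf : ∫⁻ x in Ω, φ x (f x) * ω x ≤ 1) :
    ∃ G : Rn n → ℝ≥0∞, Measurable G ∧
      ∫⁻ x, G x ^ p * ω x ≤ 1 + ∫⁻ x in Ω, (h x : ℝ≥0∞) * ω x ∧
      ∀ᵐ x ∂(volume : Measure (Rn n)), x ∈ Ω → ∀ t : ℝ≥0,
        (t : ℝ≥0∞) < maximal Ω (fun x => (f x : ℝ≥0∞)) x →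
        φ x ((min (β₁ * β ^ 2 / (1 + b * κ)) (β₂ * β ^ 2 / 2) * (t / 2 ^ n / 2) : ℝ≥0) : ℝ≥0∞)
          ^ (1 / p) ≤ b * (mx volume G x + (h x : ℝ≥0∞) ^ (1 / p)) := by
  have hp : 0 < p := by linarith
  have hp' : 0 < 1 / p := by positivity
  have mω := hM.mω
  have mφf : Measurable fun x => φ x (f x) := hφ.meas _ mf.coe_nnreal_ennreal
  set G : Rn n → ℝ≥0∞ := Ω.indicator (fun y => (φ y (f y) + h y) ^ (1 / p)) with hG
  have mG : Measurable G := ((mφf.add mh.coe_nnreal_ennreal).pow_const _).indicator hΩ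
  have hGp : ∫⁻ x, G x ^ p * ω x ≤ 1 + ∫⁻ x in Ω, (h x : ℝ≥0∞) * ω x := by
    have : ∀ x, G x ^ p * ω x = Ω.indicator (fun x => φ x (f x) * ω x + h x * ω x) x := by
      intro x
      by_cases hx : x ∈ Ω
      · simp only [hG, indicator_of_mem hx]
        rw [← ENNReal.rpow_mul, one_div_mul_cancel hp.ne', ENNReal.rpow_one, add_mul]
      · simp [hG, indicator_of_notMem hx, hp]
    simp_rw [this]
    have mm : Measurable fun x => φ x (f x) * ω x := mφf.mul mω
    rw [lintegral_indicator hΩ, lintegral_add_left mm]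
    gcongr
  refine ⟨G, mG, hGp, ?_⟩
  have hA1' : ∀ᵐ x ∂(volume : Measure (Rn n)), ∀ (i : ℕ) (r : ℚ), 0 < (r : ℝ) →
      wSet ω (ball (TopologicalSpace.denseSeq (Rn n) i) r) ≤ 1 →
      ∀ᵐ y ∂(volume : Measure (Rn n)),
      x ∈ ball (TopologicalSpace.denseSeq (Rn n) i) r ∩ Ω →
      y ∈ ball (TopologicalSpace.denseSeq (Rn n) i) r ∩ Ω →
        ∀ t : ℝ≥0, 1 ≤ φ y t →
          φ y t ≤ (wSet ω (ball (TopologicalSpace.denseSeq (Rn n) i) r))⁻¹ →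
          φ x (β₁ * t) ≤ φ y t := by
    rw [ae_all_iff]; intro i
    rw [ae_all_iff]; intro r
    rw [Filter.eventually_imp_distrib_left]; intro hr
    rw [Filter.eventually_imp_distrib_left]; intro hw
    exact hA1 _ _ hr hw
  filter_upwards [hPt, hA1', hA2] with x hPx hA1x hA2x hxΩ t ht
  obtain ⟨i, r, hr, hxB, htB⟩ := rational_ball Ω _ x _ ht
  set z := TopologicalSpace.denseSeq (Rn n) i
  specialize hA1x i r hr
  have mB : MeasurableSet (ball z (r : ℝ) ∩ Ω) := measurableSet_ball.inter hΩ
  have hV0 : volume (ball z (r : ℝ)) ≠ 0 := (measure_ball_pos volume z hr).ne'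
  have hVT : volume (ball z (r : ℝ)) ≠ ∞ := measure_ball_lt_top.ne
  have hw0 := wSet_ball_ne_zero hM.mω hM.pω z r hr
  have hwT := hM.fω z r hr
  have htB' : ((t / 2 ^ n : ℝ≥0) : ℝ≥0∞) <
      (volume (ball z (r : ℝ)))⁻¹ * ∫⁻ y in ball z (r : ℝ) ∩ Ω, (f y : ℝ≥0∞) := by
    rw [ENNReal.coe_div (by positivity)]
    rw [ENNReal.div_lt_iff (by simp) (by simp), mul_comm]
    simpa using htB
  have hsub : (volume (ball z (r : ℝ)))⁻¹ * ∫⁻ y in ball z (r : ℝ) ∩ Ω, G y ≤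
      (volume (ball z (r : ℝ)))⁻¹ * ∫⁻ y in ball z (r : ℝ), G y := by
    gcongr
    exact inter_subset_left
  have := ball_key (μ := volume.restrict (ball z (r : ℝ) ∩ Ω)) (V := volume (ball z (r : ℝ)))
    hV0 hVT (by rw [Measure.restrict_apply_univ]; exact measure_mono inter_subset_left)
    hb hβ hβ₁ hβ₁' hβ₂ hβ' hκ (hPx hxΩ) (ψ := fun y t => φ y t ^ (1 / p))
    (by
      rw [ae_restrict_iff' mB]
      filter_upwards [hPt] with y hy hyB using hy hyB.2)
    (W := ((wSet ω (ball z (r : ℝ)))⁻¹) ^ (1 / p))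
    (by
      intro hW
      have hw1 : wSet ω (ball z (r : ℝ)) ≤ 1 := by
        by_contra! hcon
        exact absurd hW (not_le.2 (ENNReal.rpow_lt_one (ENNReal.inv_lt_one.2 hcon) hp'))
      rw [ae_restrict_iff' mB]
      filter_upwards [hA1x hw1] with y hy hyB t h1 h2
      refine ENNReal.rpow_le_rpow (hy ⟨hxB, hxΩ⟩ hyB t ?_ ?_) hp'.le
      · by_contra! hcon
        exact absurd h1 (not_le.2 (ENNReal.rpow_lt_one hcon hp'))
      · exact (ENNReal.rpow_le_rpow_iff hp').1 h2)
    mf (G := G) (H := (h x : ℝ≥0∞) ^ (1 / p))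
    (by
      rw [ae_restrict_iff' mB]
      refine Eventually.of_forall fun y hy => ?_
      simp only [hG, indicator_of_mem hy.2]
      exact ENNReal.rpow_le_rpow le_self_add hp'.le)
    (by
      rw [ae_restrict_iff' mB]
      filter_upwards [hA2x, hφ.mono] with y hy hmy hyB t h1 htf
      have h1' : φ y t ≤ (1 : ℝ≥0) := by
        by_contra! hcon
        exact absurd h1 (not_le.2 (ENNReal.one_lt_rpow (by simpa using hcon) hp'))
      simp only [hG, indicator_of_mem hyB.2]
      refine le_trans ?_ (ENNReal.rpow_add_le_add_rpow _ _ hp'.le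
        ((div_le_one hp).2 hp1.le))
      refine ENNReal.rpow_le_rpow ((hy hxΩ hyB.2 t h1').trans ?_) hp'.le
      rw [add_right_comm]
      gcongr
      exact hmy hyB.2 (by exact_mod_cast htf))
    (by
      refine hsub.trans ?_
      have h1 := hM.avg G mG z r hr
      have hwp0 : wSet ω (ball z (r : ℝ)) ^ (1 / p) ≠ 0 := by
        simp [hw0, hwT]
      have hwpT : wSet ω (ball z (r : ℝ)) ^ (1 / p) ≠ ∞ :=
        ENNReal.rpow_ne_top_of_nonneg hp'.le hwT
      have h2 : K * (∫⁻ y in ball z (r : ℝ), G y ^ p * ω y) ^ (1 / p) ≤ κ := by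
        refine le_trans ?_ hKκ
        gcongr
        exact (setLIntegral_le_lintegral _ _).trans hGp
      rw [ENNReal.inv_rpow, ← div_eq_mul_inv]
      rw [ENNReal.le_div_iff_mul_le (Or.inl hwp0) (Or.inl hwpT), mul_comm]
      exact h1.trans h2)
    (t / 2 ^ n) htB'
  refine this.trans ?_
  gcongr
  exact hsub.trans (le_mx z r hr hxB)

end MaxOrlicz

namespace MaxOrlicz

lemma top_step {φx : ℝ≥0∞ → ℝ≥0∞} {p : ℝ} (hp : 0 < p) {b β c₀ L : ℝ≥0} (hc : 0 < c₀)
    (hL : 1 ≤ L) (hP : Pt (fun t => φx t ^ (1 / p)) b β) (hz : φx 0 = 0)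
    (htop : Tendsto (fun t : ℝ≥0 => φx t) atTop (𝓝 ∞)) {M A : ℝ≥0∞}
    (hA : ∀ t : ℝ≥0, (t : ℝ≥0∞) < M → φx ((c₀ * t : ℝ≥0) : ℝ≥0∞) ^ (1 / p) ≤ A) :
    φx (((c₀ / L / 2 : ℝ≥0) : ℝ≥0∞) * M) ≤ (((b / L : ℝ≥0) : ℝ≥0∞) * A) ^ p := by
  have hL0 : 0 < L := lt_of_lt_of_le one_pos hL
  have step : ∀ t : ℝ≥0, (t : ℝ≥0∞) < M →
      φx ((c₀ / L * t : ℝ≥0) : ℝ≥0∞) ≤ (((b / L : ℝ≥0) : ℝ≥0∞) * A) ^ p := by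
    intro t ht
    rcases eq_or_ne t 0 with rfl | ht0
    · simp [hz]
    have hle : c₀ / L * t ≤ c₀ * t := by
      gcongr
      exact div_le_self (by positivity) hL
    have h1 := hP.inc _ _ hle
    have hne : ((c₀ * t : ℝ≥0) : ℝ≥0∞) ≠ 0 := by
      exact_mod_cast (mul_ne_zero hc.ne' ht0)
    have h2 : φx ((c₀ / L * t : ℝ≥0) : ℝ≥0∞) ^ (1 / p) ≤ ((b / L : ℝ≥0) : ℝ≥0∞) * A := by
      rw [← ENNReal.mul_le_mul_iff_left hne ENNReal.coe_ne_top]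
      refine h1.trans ?_
      calc (b : ℝ≥0∞) * φx ((c₀ * t : ℝ≥0) : ℝ≥0∞) ^ (1 / p) * ((c₀ / L * t : ℝ≥0) : ℝ≥0∞)
          ≤ (b : ℝ≥0∞) * A * ((c₀ / L * t : ℝ≥0) : ℝ≥0∞) := by gcongr; exact hA t ht
        _ = ((b * (c₀ / L * t) : ℝ≥0) : ℝ≥0∞) * A := by push_cast; ring
        _ = ((b / L * (c₀ * t) : ℝ≥0) : ℝ≥0∞) * A := by congr 2; field_simp
        _ = _ := by push_cast; ring
    have h3 := ENNReal.rpow_le_rpow h2 hp.le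
    rwa [← ENNReal.rpow_mul, one_div_mul_cancel hp.ne', ENNReal.rpow_one] at h3
  rcases eq_or_ne M ∞ with rfl | hM
  · have : ∀ u : ℝ≥0, φx u ≤ (((b / L : ℝ≥0) : ℝ≥0∞) * A) ^ p := by
      intro u
      have := step (u / (c₀ / L)) ENNReal.coe_lt_top
      rwa [mul_div_cancel₀ _ (by positivity : c₀ / L ≠ 0)] at this
    have := le_of_tendsto' htop this
    rw [top_le_iff.1 this]
    exact le_top
  lift M to ℝ≥0 using hM
  rcases eq_or_ne M 0 with rfl | hM0
  · simp [hz]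
  have := step (M / 2) (by exact_mod_cast NNReal.half_lt_self hM0)
  convert this using 2
  rw [← ENNReal.coe_mul]
  congr 1
  field_simp

lemma modular {n : ℕ} {Ω : Set (Rn n)} (hΩ : IsOpen Ω)
    {φ : Rn n → ℝ≥0∞ → ℝ≥0∞} {ω : Rn n → ℝ≥0∞} {p : ℝ} (hp1 : 1 < p)
    (hφ : IsWeakPhi Ω φ) (hA0 : A0 Ω φ) (hA1 : A1w Ω ω φ) (hA2 : A2w Ω ω φ)
    (hInc : AInc Ω φ p) (hω : MuckenhouptAq p ω) :
    ∃ c : ℝ≥0, 0 < c ∧ ∀ f : Rn n → ℝ≥0, Measurable f →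
      wModular Ω ω φ (fun x => (f x : ℝ≥0∞)) ≤ 1 →
      wModular Ω ω φ (fun x => c * maximal Ω (fun x => (f x : ℝ≥0∞)) x) ≤ 1 := by
  have hp : 0 < p := by linarith
  have hp' : 0 < 1 / p := by positivity
  obtain ⟨a, ha, hInc⟩ := hInc
  obtain ⟨β, hβ, hβ', hA0⟩ := hA0
  obtain ⟨β₁, hβ₁, hβ₁', hA1⟩ := hA1
  obtain ⟨β₂, hβ₂, hβ₂', h, ⟨mh, hhfin, -⟩, hA2⟩ := hA2 1 one_pos
  obtain ⟨q, σ, K, hM⟩ := mpair_of_Ap hp1 hω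
  obtain ⟨CM, hCM, hmuck⟩ := hM.muckenhoupt
  set S := ∫⁻ x in Ω, (h x : ℝ≥0∞) * ω x with hS
  set b : ℝ≥0 := a ^ (1 / p) with hbdef
  have hb : 1 ≤ b := NNReal.one_le_rpow ha hp'.le
  have hPt : ∀ᵐ x ∂(volume : Measure (Rn n)), x ∈ Ω → Pt (fun t => φ x t ^ (1 / p)) b β := by
    filter_upwards [hφ.mono, hφ.map_zero, hInc, hA0] with x h1 h2 h3 h4 hx
    exact pt_of hp ha (h1 hx) (h2 hx) (h3 hx) hβ (h4 hx).1 (h4 hx).2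
  have hKS : K * (1 + S) ^ (1 / p) ≠ ∞ :=
    ENNReal.mul_ne_top hM.kfin (ENNReal.rpow_ne_top_of_nonneg hp'.le (by simp [hhfin]))
  set κ : ℝ≥0 := max 1 (K * (1 + S) ^ (1 / p)).toNNReal with hκdef
  have hκ : 1 ≤ κ := le_max_left _ _
  have hKκ : K * (1 + S) ^ (1 / p) ≤ κ := by
    rw [← ENNReal.coe_toNNReal hKS]
    exact_mod_cast le_max_right _ _
  set c₀ : ℝ≥0 := min (β₁ * β ^ 2 / (1 + b * κ)) (β₂ * β ^ 2 / 2) / (2 ^ n * 2) with hc₀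
  have hc₀p : 0 < c₀ := by
    have : 0 < min (β₁ * β ^ 2 / (1 + b * κ)) (β₂ * β ^ 2 / 2) :=
      lt_min (by positivity) (by positivity)
    positivity
  set T : ℝ≥0∞ := 2 ^ (p - 1) * (CM * (1 + S) + S) with hT
  have hTfin : T ≠ ∞ := by
    refine ENNReal.mul_ne_top (ENNReal.rpow_ne_top_of_nonneg (by linarith) (by simp)) ?_
    exact ENNReal.add_ne_top.2 ⟨ENNReal.mul_ne_top hCM (by simp [hhfin]), hhfin⟩
  have hbT : (b : ℝ≥0∞) * b * T ^ (1 / p) ≠ ∞ :=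
    ENNReal.mul_ne_top (ENNReal.mul_ne_top (by simp) (by simp))
      (ENNReal.rpow_ne_top_of_nonneg hp'.le hTfin)
  set L : ℝ≥0 := max 1 ((b : ℝ≥0∞) * b * T ^ (1 / p)).toNNReal with hL
  have hL1 : 1 ≤ L := le_max_left _ _
  have hL0 : L ≠ 0 := (lt_of_lt_of_le one_pos hL1).ne'
  have hbL : (b : ℝ≥0∞) * b * T ^ (1 / p) ≤ L := by
    rw [← ENNReal.coe_toNNReal hbT]
    exact_mod_cast le_max_right _ _
  refine ⟨c₀ / L / 2, by positivity, fun f mf hf => ?_⟩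
  obtain ⟨G, mG, hGp, hkey⟩ := key hΩ.measurableSet hp1 hφ hb hβ hβ₁ hβ₁' hβ₂ hβ' hκ hPt hA1 mh
    (by simpa using hA2) hM hKκ mf hf
  have hpt : ∀ᵐ x ∂(volume : Measure (Rn n)), x ∈ Ω →
      φ x (((c₀ / L / 2 : ℝ≥0) : ℝ≥0∞) * maximal Ω (fun x => (f x : ℝ≥0∞)) x) ≤
      (((b / L : ℝ≥0) : ℝ≥0∞) * (b * (mx volume G x + (h x : ℝ≥0∞) ^ (1 / p)))) ^ p := by
    filter_upwards [hPt, hφ.map_zero, hφ.tendsto_top, hkey] with x h1 h2 h3 h4 hx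
    refine top_step hp hc₀p hL1 (h1 hx) (h2 hx) (h3 hx) fun t ht => ?_
    have := h4 hx t ht
    convert this using 4
    rw [hc₀]
    field_simp
  have mω := hM.mω
  have hcombine : ∫⁻ x in Ω, (mx volume G x + (h x : ℝ≥0∞) ^ (1 / p)) ^ p * ω x ≤ T := by
    calc ∫⁻ x in Ω, (mx volume G x + (h x : ℝ≥0∞) ^ (1 / p)) ^ p * ω x
        ≤ ∫⁻ x in Ω, 2 ^ (p - 1) * ((mx volume G x) ^ p * ω x + h x * ω x) := by
          refine lintegral_mono fun x => ?_
          have := ENNReal.rpow_add_le_mul_rpow_add_rpow (mx volume G x)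
            ((h x : ℝ≥0∞) ^ (1 / p)) hp1.le
          rw [← ENNReal.rpow_mul (h x : ℝ≥0∞), one_div_mul_cancel hp.ne', ENNReal.rpow_one] at this
          rw [← add_mul, ← mul_assoc]
          dsimp only
          gcongr
      _ = 2 ^ (p - 1) * ((∫⁻ x in Ω, (mx volume G x) ^ p * ω x) + S) := by
          have m1 : Measurable fun x => (mx volume G x) ^ p * ω x :=
            ((measurable_mx volume G).pow_const _).mul mω
          rw [lintegral_const_mul' _ _ (ENNReal.rpow_ne_top_of_nonneg (by linarith) (by simp)),
            lintegral_add_left m1]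
      _ ≤ T := by
          rw [hT]
          gcongr
          refine (setLIntegral_le_lintegral _ _).trans ((hmuck G mG).trans ?_)
          gcongr
  unfold wModular
  calc ∫⁻ x in Ω, φ x (((c₀ / L / 2 : ℝ≥0) : ℝ≥0∞) * maximal Ω (fun x => (f x : ℝ≥0∞)) x) * ω x
      ≤ ∫⁻ x in Ω, (((b / L : ℝ≥0) : ℝ≥0∞) * b) ^ p *
          ((mx volume G x + (h x : ℝ≥0∞) ^ (1 / p)) ^ p * ω x) := by
        refine lintegral_mono_ae ?_
        refine (ae_restrict_iff' hΩ.measurableSet).2 ?_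
        filter_upwards [hpt] with x hx hxΩ
        rw [← mul_assoc, ← ENNReal.mul_rpow_of_nonneg _ _ hp.le, mul_assoc _ (b : ℝ≥0∞)]
        gcongr
        exact hx hxΩ
    _ = (((b / L : ℝ≥0) : ℝ≥0∞) * b) ^ p *
          ∫⁻ x in Ω, ((mx volume G x + (h x : ℝ≥0∞) ^ (1 / p)) ^ p * ω x) := by
        rw [lintegral_const_mul' _ _ (ENNReal.rpow_ne_top_of_nonneg hp.le
          (ENNReal.mul_ne_top (by simp) (by simp)))]
    _ ≤ (((b / L : ℝ≥0) : ℝ≥0∞) * b) ^ p * T := by gcongr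
    _ = (((b / L : ℝ≥0) : ℝ≥0∞) * b * T ^ (1 / p)) ^ p := by
        rw [ENNReal.mul_rpow_of_nonneg _ (T ^ (1 / p)) hp.le, ← ENNReal.rpow_mul T,
          one_div_mul_cancel hp.ne', ENNReal.rpow_one]
    _ ≤ 1 := by
        refine ENNReal.rpow_le_one ?_ hp.le
        rw [ENNReal.coe_div hL0]
        calc (b : ℝ≥0∞) / L * b * T ^ (1 / p) = (b : ℝ≥0∞) * b * T ^ (1 / p) / L := by
              simp only [div_eq_mul_inv]; ring
          _ ≤ 1 := ENNReal.div_le_of_le_mul (by simpa using hbL)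

lemma maximal_div {n : ℕ} (Ω : Set (Rn n)) (g : Rn n → ℝ≥0∞) (lam : ℝ≥0) (hl : 0 < lam)
    (x : Rn n) : maximal Ω (fun y => g y / lam) x = maximal Ω g x / lam := by
  have hfin : (lam : ℝ≥0∞)⁻¹ ≠ ∞ := by simp [hl.ne']
  unfold maximal
  simp only [div_eq_mul_inv, lintegral_mul_const' _ _ hfin, ENNReal.iSup_mul, mul_assoc]

end MaxOrlicz

/-- Boundedness of the maximal operator on the weighted
generalized Orlicz space. -/
theorem maximal_bounded_weighted_orlicz
    (n : ℕ) (Ω : Set (Rn n)) (hΩ : IsOpen Ω)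
    (φ : Rn n → ℝ≥0∞ → ℝ≥0∞) (ω : Rn n → ℝ≥0∞) (p : ℝ) (hp1 : 1 < p)
    (hφ : IsWeakPhi Ω φ) (hA0 : A0 Ω φ) (hA1 : A1w Ω ω φ) (hA2 : A2w Ω ω φ)
    (hInc : AInc Ω φ p) (hω : MuckenhouptAq p ω) :
    ∃ C : ℝ≥0, 0 < C ∧ ∀ f : Rn n → ℝ, Measurable f →
      MemLw Ω ω φ (fun x => (‖f x‖₊ : ℝ≥0∞)) →
        wNorm Ω ω φ (maximal Ω fun x => (‖f x‖₊ : ℝ≥0∞)) ≤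
          C * wNorm Ω ω φ (fun x => (‖f x‖₊ : ℝ≥0∞)) := by
  obtain ⟨c, hc, H⟩ := MaxOrlicz.modular hΩ hp1 hφ hA0 hA1 hA2 hInc hω
  refine ⟨c⁻¹, by positivity, fun f mf _ => ?_⟩
  have hcT : ((c⁻¹ : ℝ≥0) : ℝ≥0∞) ≠ ∞ := ENNReal.coe_ne_top
  have hc0 : ((c⁻¹ : ℝ≥0) : ℝ≥0∞) ≠ 0 := by simp [hc.ne']
  rw [mul_comm, ← ENNReal.div_le_iff hc0 hcT]
  conv_rhs => unfold wNorm
  refine le_iInf fun lam => le_iInf fun hl => le_iInf fun hmod => ?_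
  rw [ENNReal.div_le_iff hc0 hcT]
  have h1 : ∀ x, (‖f x‖₊ : ℝ≥0∞) / lam = ((‖f x‖₊ / lam : ℝ≥0) : ℝ≥0∞) := fun x => by
    rw [ENNReal.coe_div hl.ne']
  have h2 := H (fun x => ‖f x‖₊ / lam) (mf.nnnorm.div_const _) (by simpa only [h1] using hmod)
  have h3 : wModular Ω ω φ (fun x => maximal Ω (fun x => (‖f x‖₊ : ℝ≥0∞)) x /
      ((lam * c⁻¹ : ℝ≥0) : ℝ≥0∞)) ≤ 1 := by
    convert h2 using 3 with x
    simp only [← h1]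
    rw [MaxOrlicz.maximal_div _ _ _ hl, ENNReal.coe_mul, ENNReal.coe_inv hc.ne',
      div_eq_mul_inv, div_eq_mul_inv, ENNReal.mul_inv (by simp [hc.ne']) (by simp [hc.ne']), inv_inv]
    ring
  rw [← ENNReal.coe_mul]
  unfold wNorm
  exact iInf_le_of_le (lam * c⁻¹) (iInf_le_of_le (by positivity) (iInf_le_of_le h3 le_rfl))
end
end

section
/- Let Ω ⊆ ℝⁿ be open, let φ ∈ Φ_w(Ω) satisfy (A0), (A1)_ω, (A2)_ω and (aInc)_p with p ∈ (1,∞), and let ω ∈ A_p. Then there exist β > 0, a nonnegative h ∈ L¹(Ω,ω) ∩ L^∞(Ω), and a constant C > 0 such that φ(x, β·Mf(x))^{1/p} ≤ C ( M(φ(·,|f|)^{1/p})(x) + M(h^{1/p})(x) ) for a.e. x ∈ Ω and every f ∈ L^φ(Ω,ω) with ρ_φ^ω(f) ≤ 1. -/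
open MeasureTheory Metric Filter Set
open scoped ENNReal NNReal Topology

noncomputable section

/-! ### Deterministic lemmas -/

lemma pme_root_ainc {g : ℝ≥0∞ → ℝ≥0∞} {p : ℝ} (hp : 1 < p) {a : ℝ≥0} (ha : 1 ≤ a)
    (H : ∀ s t : ℝ≥0, 0 < s → s < t → g s / (s : ℝ≥0∞) ^ p ≤ a * (g t / (t : ℝ≥0∞) ^ p))
    (s t : ℝ≥0) (hs : 0 < s) (hst : s < t) :
    (g s) ^ (1 / p) * t ≤ a * (g t) ^ (1 / p) * s := by
  have hp0 : 0 < p := by linarith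
  have ht : 0 < t := hs.trans hst
  have h1 := ENNReal.rpow_le_rpow (H s t hs hst) (show 0 ≤ 1 / p by positivity)
  rw [ENNReal.mul_rpow_of_nonneg _ _ (by positivity), ENNReal.div_rpow_of_nonneg _ _ (by positivity),
    ENNReal.div_rpow_of_nonneg _ _ (by positivity), ← ENNReal.rpow_mul, ← ENNReal.rpow_mul,
    mul_one_div_cancel hp0.ne', ENNReal.rpow_one, ENNReal.rpow_one] at h1
  have h2 : (a : ℝ≥0∞) ^ (1 / p) ≤ a := by
    calc (a : ℝ≥0∞) ^ (1 / p) ≤ (a : ℝ≥0∞) ^ (1 : ℝ) :=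
          ENNReal.rpow_le_rpow_of_exponent_le (by exact_mod_cast ha)
            (by rw [div_le_one hp0]; exact hp.le)
      _ = a := ENNReal.rpow_one _
  have hs' : (s : ℝ≥0∞) ≠ 0 := by exact_mod_cast hs.ne'
  have ht' : (t : ℝ≥0∞) ≠ 0 := by exact_mod_cast ht.ne'
  have h3 : g s ^ (1 / p) / s ≤ a * (g t ^ (1 / p) / t) := h1.trans (by gcongr)
  calc (g s) ^ (1 / p) * t = (g s ^ (1 / p) / s) * (s * t) := by
        rw [← mul_assoc, ENNReal.div_mul_cancel hs' ENNReal.coe_ne_top]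
    _ ≤ (a * (g t ^ (1 / p) / t)) * (s * t) := by gcongr
    _ = a * (g t ^ (1 / p) / t * t) * s := by ring
    _ = _ := by rw [ENNReal.div_mul_cancel ht' ENNReal.coe_ne_top]

lemma pme_exists_T {g : ℝ≥0∞ → ℝ≥0∞} (hm : Monotone g)
    (h0 : Tendsto (fun t : ℝ≥0 => g t) (𝓝[>] 0) (𝓝 0))
    (hi : Tendsto (fun t : ℝ≥0 => g t) atTop (𝓝 ∞)) {α : ℝ≥0} (hα : 0 < α) :
    ∃ T : ℝ≥0, 0 < T ∧ g T ≤ α ∧ α < g (2 * T : ℝ≥0) := by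
  have hα' : (0 : ℝ≥0∞) < α := by exact_mod_cast hα
  have e1 : ∀ᶠ t : ℝ≥0 in 𝓝[>] 0, g t < α := h0.eventually (gt_mem_nhds hα')
  obtain ⟨t0, ht0, ht0'⟩ := (e1.and self_mem_nhdsWithin).exists
  have ht0' : 0 < t0 := ht0'
  have e2 : ∀ᶠ t : ℝ≥0 in atTop, α < g t := hi.eventually (lt_mem_nhds ENNReal.coe_lt_top)
  obtain ⟨t1, ht1⟩ := e2.exists
  have e3 : ∃ N : ℕ, α < g ((2 ^ N * t0 : ℝ≥0) : ℝ≥0∞) := by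
    obtain ⟨N, hN⟩ := pow_unbounded_of_one_lt (t1 / t0) (one_lt_two : (1 : ℝ≥0) < 2)
    refine ⟨N, ht1.trans_le (hm ?_)⟩
    rw [div_lt_iff₀ ht0'] at hN
    exact_mod_cast hN.le
  classical
  have hN0 : Nat.find e3 ≠ 0 := by
    intro h
    have := Nat.find_spec e3
    rw [h] at this
    simp only [pow_zero, one_mul] at this
    exact absurd this (not_lt.2 ht0.le)
  obtain ⟨m, hm'⟩ := Nat.exists_eq_succ_of_ne_zero hN0
  refine ⟨2 ^ m * t0, by positivity, ?_, ?_⟩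
  · exact not_lt.1 (Nat.find_min e3 (by omega : m < Nat.find e3))
  · have := Nat.find_spec e3
    rw [hm', Nat.succ_eq_add_one, pow_succ'] at this
    rwa [← mul_assoc]

lemma pme_big {χ : ℝ≥0∞ → ℝ≥0∞} {a c P t u α S : ℝ≥0} (ha : 1 ≤ a) (hc : 0 < c) (hP : 0 < P)
    (ht : 0 < t) (htu : t < u) (hα : 0 < α) (hS : α * t = S * P)
    (hχ : ∀ s t : ℝ≥0, 0 < s → s < t → χ s * t ≤ a * χ t * s)
    (h : (c : ℝ≥0∞) * P ≤ χ t) : (α : ℝ≥0∞) * u ≤ S * ((a / c : ℝ≥0) * χ u) := by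
  rcases eq_or_ne (χ u) ∞ with hu | hu
  · have hS0 : S ≠ 0 := by
      rintro rfl
      rw [zero_mul] at hS
      exact absurd hS (mul_pos hα ht).ne'
    have hac : ((a / c : ℝ≥0) : ℝ≥0∞) ≠ 0 := by
      have ha0 : 0 < a := by positivity
      exact_mod_cast (div_pos ha0 hc).ne'
    rw [hu, ENNReal.mul_top hac, ENNReal.mul_top (by exact_mod_cast hS0)]
    exact le_top
  lift χ u to ℝ≥0 using hu with X hX
  have h1 := hχ t u ht htu
  rw [← hX] at h1
  have h2 : (c : ℝ≥0∞) * P * u ≤ a * X * t := le_trans (by gcongr) h1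
  norm_cast at h2 ⊢
  have h3 : (c * P) * (α * u) ≤ (c * P) * (S * (a / c * X)) := by
    calc (c * P) * (α * u) = α * (c * P * u) := by ring
      _ ≤ α * (a * X * t) := by gcongr
      _ = (α * t) * a * X := by ring
      _ = S * P * a * X := by rw [hS]
      _ = _ := by field_simp
  exact le_of_mul_le_mul_left h3 (by positivity)

lemma pme_coreII {ψ χ : ℝ≥0∞ → ℝ≥0∞} {a c K β₂ α T hx hy u : ℝ≥0} (ha : 1 ≤ a) (hc : 0 < c)
    (hc1 : c ≤ 1) (hα : 0 < α) (hT : 0 < T)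
    (hψ : ∀ s t : ℝ≥0, 0 < s → s < t → ψ s * t ≤ a * ψ t * s)
    (hχ : ∀ s t : ℝ≥0, 0 < s → s < t → χ s * t ≤ a * χ t * s)
    (hT2 : α < ψ (2 * T : ℝ≥0)) (hxα : hx ≤ α) (hcP : c * (α + hy) ≤ 1)
    (A2 : ∀ t : ℝ≥0, χ t ≤ 1 → ψ (β₂ * t : ℝ≥0) ≤ χ t + hx + hy)
    (hK : 6 * a ≤ β₂ * K) :
    (α : ℝ≥0∞) * u ≤ (K * T : ℝ≥0) * (α + hy + (a / c : ℝ≥0) * χ u) := by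
  set P := α + hy with hP
  have hP0 : 0 < P := by positivity
  have hK0 : 0 < K := by
    rcases eq_or_ne K 0 with h | h
    · rw [h] at hK; simp at hK; rw [hK] at ha; simp at ha
    · exact pos_iff_ne_zero.2 h
  set t := K * T * P / α with ht
  have ht0 : 0 < t := by positivity
  have hαt : α * t = K * T * P := by rw [ht]; field_simp
  rcases le_or_gt u t with h | h
  · calc (α : ℝ≥0∞) * u ≤ α * t := by gcongr
      _ = ((K * T : ℝ≥0) : ℝ≥0∞) * (α + hy) := by
        rw [← ENNReal.coe_mul, hαt]; push_cast [hP]; ring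
      _ ≤ _ := mul_le_mul' le_rfl le_self_add
  rcases le_or_gt ((c : ℝ≥0∞) * P) (χ t) with h2 | h2
  · calc (α : ℝ≥0∞) * u ≤ (K * T : ℝ≥0) * ((a / c : ℝ≥0) * χ u) :=
        pme_big ha hc hP0 ht0 h hα hαt hχ h2
      _ ≤ _ := by gcongr; exact le_add_self
  exfalso
  have h3 : χ t ≤ 1 := h2.le.trans (by exact_mod_cast hcP)
  have h4 := A2 t h3
  have h5 : ψ (β₂ * t : ℝ≥0) ≤ (2 * P : ℝ≥0) := by
    refine h4.trans ?_
    calc χ t + hx + hy ≤ (1 : ℝ≥0) * P + α + hy := by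
          gcongr
          exact h2.le.trans (by gcongr)
      _ = _ := by push_cast [hP]; ring
  have h6 : 2 * T < β₂ * t := by
    have : (2 * T) * α < (β₂ * t) * α := by
      calc (2 * T) * α < 6 * T * α := by gcongr; norm_num
        _ ≤ 6 * a * T * P := by
          have : α ≤ a * P := by
            calc α = 1 * α := by ring
              _ ≤ a * P := by gcongr; exact le_self_add
          calc 6 * T * α ≤ 6 * T * (a * P) := by gcongr
            _ = _ := by ring
        _ ≤ β₂ * K * T * P := by gcongr
        _ = β₂ * (α * t) := by rw [hαt]; ring
        _ = _ := by ring
    exact lt_of_mul_lt_mul_right this (by positivity)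
  have h7 := hψ (2 * T) (β₂ * t) (by positivity) h6
  have h8 : (α : ℝ≥0∞) * (β₂ * t : ℝ≥0) ≤ a * (2 * P : ℝ≥0) * (2 * T : ℝ≥0) := by
    calc (α : ℝ≥0∞) * (β₂ * t : ℝ≥0) ≤ ψ (2 * T : ℝ≥0) * (β₂ * t : ℝ≥0) := by gcongr
      _ ≤ _ := h7
      _ ≤ _ := by gcongr
  norm_cast at h8
  have h9 : 6 * a * T * P ≤ 4 * a * T * P := by
    calc 6 * a * T * P ≤ β₂ * K * T * P := by gcongr
      _ = α * (β₂ * t) := by rw [show α * (β₂ * t) = β₂ * (α * t) by ring, hαt]; ring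
      _ ≤ _ := h8
      _ = _ := by ring
  have ha0 : 0 < a := by positivity
  have h10 : 4 * a * T * P < 6 * a * T * P := by gcongr; norm_num
  exact absurd h9 (not_le.2 h10)

lemma pme_coreI {ψ χ : ℝ≥0∞ → ℝ≥0∞} {a c K β₀ β₁ α T hy u : ℝ≥0} {w : ℝ≥0∞} (ha : 1 ≤ a) (hc : 0 < c)
    (hc1 : c ≤ 1) (hα : 1 ≤ α) (hT : 0 < T) (hψm : Monotone ψ) (hχm : Monotone χ)
    (hχ : ∀ s t : ℝ≥0, 0 < s → s < t → χ s * t ≤ a * χ t * s)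
    (hT2 : α < ψ (2 * T : ℝ≥0)) (hcw : c * α * w ≤ 1) (hβ₀ : 0 < β₀)
    (A0x : ψ β₀ ≤ 1) (A0y : 1 ≤ χ (β₀⁻¹ : ℝ≥0))
    (A1 : ∀ t : ℝ≥0, 1 ≤ χ t → χ t * w ≤ 1 → ψ (β₁ * t : ℝ≥0) ≤ χ t)
    (hK0 : 0 < K) (hK1 : 2 ≤ β₁ * K) (hK2 : 2 ≤ β₀ * β₀ * K) :
    (α : ℝ≥0∞) * u ≤ (K * T : ℝ≥0) * (α + hy + (a / c : ℝ≥0) * χ u) := by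
  have hα0 : 0 < α := by positivity
  set t := K * T with ht
  have ht0 : 0 < t := by positivity
  rcases le_or_gt u t with h | h
  · calc (α : ℝ≥0∞) * u ≤ α * t := by gcongr
      _ = t * α := mul_comm _ _
      _ ≤ _ := by gcongr; rw [add_assoc]; exact le_self_add
  rcases le_or_gt ((c : ℝ≥0∞) * α) (χ t) with h2 | h2
  · calc (α : ℝ≥0∞) * u ≤ t * ((a / c : ℝ≥0) * χ u) :=
        pme_big ha hc hα0 ht0 h hα0 (mul_comm _ _) hχ h2
      _ ≤ _ := by gcongr; exact le_add_self
  exfalso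
  have h2' : χ t ≤ α := h2.le.trans (by
    calc (c : ℝ≥0∞) * α ≤ (1 : ℝ≥0) * α := by gcongr
      _ = α := by simp)
  rcases le_or_gt 1 (χ t) with h3 | h3
  · have h4 := A1 t h3 (le_trans (by gcongr) hcw)
    have h5 : ψ (2 * T : ℝ≥0) ≤ ψ (β₁ * t : ℝ≥0) := by
      apply hψm
      norm_cast
      rw [ht, ← mul_assoc]
      gcongr
    exact absurd (h5.trans (h4.trans h2')) (not_le.2 hT2)
  · have h4 : t < β₀⁻¹ := by
      by_contra hcon
      push Not at hcon
      exact absurd (A0y.trans (hχm (by exact_mod_cast hcon))) (not_le.2 h3)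
    have h5 : β₀ < 2 * T := by
      by_contra hcon
      push Not at hcon
      have : ψ (2 * T : ℝ≥0) ≤ α :=
        (hψm (by exact_mod_cast hcon)).trans (A0x.trans (by exact_mod_cast hα))
      exact absurd this (not_le.2 hT2)
    have h6 : t * β₀ < 1 := by
      calc t * β₀ < β₀⁻¹ * β₀ := by gcongr
        _ = 1 := inv_mul_cancel₀ hβ₀.ne'
    have h7 : 2 ≤ 2 * (t * β₀) := by
      calc 2 ≤ β₀ * β₀ * K := hK2
        _ ≤ β₀ * (2 * T) * K := by gcongr
        _ = _ := by rw [ht]; ring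
    have h8 : 2 * (t * β₀) < 2 * 1 := by gcongr
    exact absurd h7 (not_le.2 (by simpa using h8))

/-! ### Measure-theoretic lemmas -/

lemma pme_vol_double {n : ℕ} (z z' : Rn n) {r s : ℝ} (hr : 0 < r) (hs : s ≤ 2 * r) :
    volume (ball z' s) ≤ (2 ^ n : ℝ≥0) * volume (ball z r) := by
  calc volume (ball z' s) ≤ volume (ball z' (2 * r)) := measure_mono (ball_subset_ball hs)
    _ = ENNReal.ofReal (2 ^ Module.finrank ℝ (Rn n)) * volume (ball (0 : Rn n) r) :=
      Measure.addHaar_ball_mul_of_pos _ _ (by norm_num) _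
    _ = (2 ^ n : ℝ≥0) * volume (ball z r) := by
      rw [← Measure.addHaar_ball_center volume z r, finrank_euclideanSpace_fin]
      congr 1
      rw [ENNReal.ofReal, Real.toNNReal_pow (by norm_num)]
      norm_num

lemma pme_le_maximal {n : ℕ} {Ω : Set (Rn n)} {g : Rn n → ℝ≥0∞} {x z : Rn n} {r : ℝ}
    (hr : 0 < r) (hx : x ∈ ball z r) :
    (volume (ball z r))⁻¹ * ∫⁻ y in ball z r ∩ Ω, g y ≤ maximal Ω g x := by
  unfold maximal
  exact le_iSup_of_le z (le_iSup_of_le r (le_iSup_of_le hr (le_iSup_of_le hx le_rfl)))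

/-- Lebesgue differentiation: a bounded function is controlled by its maximal function. -/
lemma pme_lebesgue {n : ℕ} {Ω : Set (Rn n)} (hΩ : IsOpen Ω) {g : Rn n → ℝ≥0} (hg : Measurable g)
    {H : ℝ≥0} (hH : ∀ᵐ x ∂(volume : Measure (Rn n)), x ∈ Ω → g x ≤ H) :
    ∀ᵐ x ∂(volume : Measure (Rn n)), x ∈ Ω →
      (g x : ℝ≥0∞) ≤ (2 ^ n : ℝ≥0) * maximal Ω (fun y => (g y : ℝ≥0∞)) x := by
  set G : Rn n → ℝ≥0∞ := Ω.indicator (fun y => (g y : ℝ≥0∞)) with hG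
  have hGm : Measurable G := (hg.coe_nnreal_ennreal).indicator hΩ.measurableSet
  have hle : volume.withDensity G ≤ (H : ℝ≥0∞) • (volume : Measure (Rn n)) := by
    rw [← withDensity_const]
    apply withDensity_mono
    filter_upwards [hH] with x hx
    by_cases h : x ∈ Ω
    · simp only [hG, indicator_of_mem h]
      exact_mod_cast hx h
    · simp [hG, h]
  have : IsLocallyFiniteMeasure ((H : ℝ≥0∞) • (volume : Measure (Rn n))) :=
    inferInstanceAs (IsLocallyFiniteMeasure (H • (volume : Measure (Rn n))))
  have : IsLocallyFiniteMeasure (volume.withDensity G) := Measure.isLocallyFiniteMeasure_of_le hle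
  filter_upwards [Besicovitch.ae_tendsto_rnDeriv (volume.withDensity G) volume,
    Measure.rnDeriv_withDensity volume hGm] with x hx hx' hxΩ
  rw [hx'] at hx
  have hGx : G x = g x := by simp [hG, hxΩ]
  rw [hGx] at hx
  refine le_of_tendsto hx ?_
  filter_upwards [self_mem_nhdsWithin] with r hr
  have hr : 0 < r := hr
  rw [withDensity_apply _ isClosed_closedBall.measurableSet, hG,
    setLIntegral_indicator hΩ.measurableSet]
  have h2r : 0 < 2 * r := by linarith
  have hsub : closedBall x r ⊆ ball x (2 * r) := closedBall_subset_ball (by linarith)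
  calc (∫⁻ y in Ω ∩ closedBall x r, (g y : ℝ≥0∞)) / volume (closedBall x r)
      ≤ (∫⁻ y in ball x (2 * r) ∩ Ω, (g y : ℝ≥0∞)) / volume (ball x r) := by
        refine ENNReal.div_le_div (lintegral_mono_set ?_) (measure_mono ball_subset_closedBall)
        rw [inter_comm]
        exact inter_subset_inter_left _ hsub
    _ ≤ (2 ^ n : ℝ≥0) *
        ((volume (ball x (2 * r)))⁻¹ * ∫⁻ y in ball x (2 * r) ∩ Ω, (g y : ℝ≥0∞)) := by
        rw [← mul_assoc, div_eq_mul_inv, mul_comm]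
        gcongr
        have h1 := pme_vol_double x x hr (le_refl (2 * r))
        have h2 : volume (ball x (2 * r)) ≠ 0 := (measure_ball_pos _ _ h2r).ne'
        have h3 : volume (ball x (2 * r)) ≠ ∞ := measure_ball_lt_top.ne
        have h4 : volume (ball x r) ≠ 0 := (measure_ball_pos _ _ hr).ne'
        have h5 : volume (ball x r) ≠ ∞ := measure_ball_lt_top.ne
        rw [← div_eq_mul_inv, ENNReal.le_div_iff_mul_le (Or.inl h2) (Or.inl h3), mul_comm,
          ← div_eq_mul_inv]
        exact ENNReal.div_le_of_le_mul h1
    _ ≤ _ := by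
        gcongr
        exact pme_le_maximal h2r (mem_ball_self h2r)

/-- The consequence of the `A_p` condition. -/
lemma pme_Ap {n : ℕ} {Ω : Set (Rn n)} {ω : Rn n → ℝ≥0∞} {p : ℝ} (hp : 1 < p)
    (hω : IsWeight ω) {C : ℝ≥0∞} {z : Rn n} {r : ℝ}
    (hC : (volume (ball z r)) ^ (-p) * wSet ω (ball z r) *
      (∫⁻ y in ball z r, (ω y) ^ (-(1 / (p - 1)))) ^ (p - 1) ≤ C)
    {g : Rn n → ℝ≥0∞} (hg : Measurable g) (hg1 : ∫⁻ x in Ω, g x * ω x ≤ 1) :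
    ((volume (ball z r))⁻¹ * ∫⁻ y in ball z r ∩ Ω, (g y) ^ (1 / p)) *
      (wSet ω (ball z r)) ^ (1 / p) ≤ C ^ (1 / p) := by
  have hp0 : 0 < p := by linarith
  have hp1 : 0 < p - 1 := by linarith
  set B := ball z r
  have hpq : p.HolderConjugate (p / (p - 1)) := Real.HolderConjugate.conjExponent hp
  have hae : ∀ᵐ y ∂(volume.restrict (B ∩ Ω)), (g y) ^ (1 / p) =
      ((fun y => (g y * ω y) ^ (1 / p)) * (fun y => (ω y) ^ (-(1 / p)))) y := by
    filter_upwards [ae_restrict_of_ae hω.2.1] with y hy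
    simp only [Pi.mul_apply]
    rw [ENNReal.mul_rpow_of_nonneg _ _ (by positivity), mul_assoc,
      ← ENNReal.rpow_add _ _ hy.1.ne' hy.2.ne]
    simp
  have hH := ENNReal.lintegral_mul_le_Lp_mul_Lq (volume.restrict (B ∩ Ω)) hpq
    (f := fun y => (g y * ω y) ^ (1 / p)) (g := fun y => (ω y) ^ (-(1 / p)))
    ((hg.mul hω.1).pow_const _).aemeasurable (hω.1.pow_const _).aemeasurable
  rw [← lintegral_congr_ae hae] at hH
  have e1 : ∀ y, ((g y * ω y) ^ (1 / p)) ^ p = g y * ω y := by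
    intro y
    rw [← ENNReal.rpow_mul, one_div_mul_cancel hp0.ne', ENNReal.rpow_one]
  have e2 : ∀ y, ((ω y) ^ (-(1 / p))) ^ (p / (p - 1)) = (ω y) ^ (-(1 / (p - 1))) := by
    intro y
    rw [← ENNReal.rpow_mul]
    congr 1
    field_simp
  simp only [e1, e2] at hH
  have h1 : ∫⁻ y in B ∩ Ω, g y * ω y ≤ 1 :=
    (lintegral_mono_set inter_subset_right).trans hg1
  set I := ∫⁻ y in B, (ω y) ^ (-(1 / (p - 1))) with hI
  have h2 : ∫⁻ y in B ∩ Ω, (g y) ^ (1 / p) ≤ I ^ (1 / (p / (p - 1))) := by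
    refine hH.trans ?_
    calc _ ≤ (1 : ℝ≥0∞) ^ (1 / p) * I ^ (1 / (p / (p - 1))) := by
          gcongr
          exact lintegral_mono_set inter_subset_left
      _ = _ := by simp
  calc _ ≤ ((volume B)⁻¹ * I ^ (1 / (p / (p - 1)))) * (wSet ω B) ^ (1 / p) := by gcongr
    _ = ((volume B) ^ (-p) * wSet ω B * I ^ (p - 1)) ^ (1 / p) := by
      rw [ENNReal.mul_rpow_of_nonneg _ _ (by positivity),
        ENNReal.mul_rpow_of_nonneg _ _ (by positivity), ← ENNReal.rpow_mul, ← ENNReal.rpow_mul,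
        show -p * (1 / p) = -1 by field_simp, ENNReal.rpow_neg_one,
        show (p - 1) * (1 / p) = 1 / (p / (p - 1)) by field_simp]
      ring
    _ ≤ _ := by gcongr

/-- Integrating the pointwise inequality over a ball. -/
lemma pme_integrate {n : ℕ} {Ω : Set (Rn n)} {z : Rn n} {r : ℝ} (hr : 0 < r)
    {F f g : Rn n → ℝ≥0∞} (hF : Measurable F) (hg : Measurable g) {α T K : ℝ≥0} (hα : 0 < α)
    (hpt : ∀ᵐ y ∂(volume : Measure (Rn n)), y ∈ ball z r ∩ Ω →
      (α : ℝ≥0∞) * f y ≤ (K * T : ℝ≥0) * (α + g y + F y))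
    (hms : MeasurableSet Ω)
    (hle : (volume (ball z r))⁻¹ * (∫⁻ y in ball z r ∩ Ω, F y) +
      (volume (ball z r))⁻¹ * (∫⁻ y in ball z r ∩ Ω, g y) ≤ α) :
    (volume (ball z r))⁻¹ * ∫⁻ y in ball z r ∩ Ω, f y ≤ (2 * K * T : ℝ≥0) := by
  set B := ball z r
  have hV0 : volume B ≠ 0 := (measure_ball_pos _ _ hr).ne'
  have hV1 : volume B ≠ ∞ := measure_ball_lt_top.ne
  have h1 : (α : ℝ≥0∞) * ∫⁻ y in B ∩ Ω, f y ≤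
      (K * T : ℝ≥0) * (α * volume B + (∫⁻ y in B ∩ Ω, g y) + ∫⁻ y in B ∩ Ω, F y) := by
    calc (α : ℝ≥0∞) * ∫⁻ y in B ∩ Ω, f y = ∫⁻ y in B ∩ Ω, α * f y :=
          (lintegral_const_mul' _ _ ENNReal.coe_ne_top).symm
      _ ≤ ∫⁻ y in B ∩ Ω, (K * T : ℝ≥0) * (α + g y + F y) :=
          setLIntegral_mono_ae' (measurableSet_ball.inter hms) hpt
      _ = (K * T : ℝ≥0) * (α * volume (B ∩ Ω) + (∫⁻ y in B ∩ Ω, g y) + ∫⁻ y in B ∩ Ω, F y) := by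
          rw [lintegral_const_mul' _ _ ENNReal.coe_ne_top, lintegral_add_right _ hF,
            lintegral_add_right _ hg, setLIntegral_const]
      _ ≤ _ := by gcongr; exact inter_subset_left
  have h2 : (α : ℝ≥0∞) * ((volume B)⁻¹ * ∫⁻ y in B ∩ Ω, f y) ≤ α * (2 * K * T : ℝ≥0) := by
    calc (α : ℝ≥0∞) * ((volume B)⁻¹ * ∫⁻ y in B ∩ Ω, f y)
        = (volume B)⁻¹ * (α * ∫⁻ y in B ∩ Ω, f y) := by ring
      _ ≤ (volume B)⁻¹ *
        ((K * T : ℝ≥0) * (α * volume B + (∫⁻ y in B ∩ Ω, g y) + ∫⁻ y in B ∩ Ω, F y)) := by gcongr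
      _ = (K * T : ℝ≥0) * (α * ((volume B)⁻¹ * volume B) +
          ((volume B)⁻¹ * (∫⁻ y in B ∩ Ω, F y) + (volume B)⁻¹ * (∫⁻ y in B ∩ Ω, g y))) := by ring
      _ ≤ (K * T : ℝ≥0) * (α * 1 + α) := by
          rw [ENNReal.inv_mul_cancel hV0 hV1]
          gcongr
      _ = _ := by push_cast; ring
  exact (ENNReal.mul_le_mul_iff_right (by exact_mod_cast hα.ne') ENNReal.coe_ne_top).1 h2

/-- Every ball is contained in a comparable ball of a fixed countable family. -/
lemma pme_rational {n : ℕ} (z : Rn n) {r : ℝ} (hr : 0 < r) :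
    ∃ (k : ℕ) (q : ℚ), (0 : ℝ) < q ∧
      ball z r ⊆ ball (TopologicalSpace.denseSeq (Rn n) k) q ∧ (q : ℝ) ≤ 2 * r := by
  obtain ⟨k, hk⟩ := (TopologicalSpace.denseRange_denseSeq (Rn n)).exists_dist_lt z
    (show 0 < r / 2 by positivity)
  obtain ⟨q, hq1, hq2⟩ := exists_rat_btwn (show 3 / 2 * r < 2 * r by linarith)
  refine ⟨k, q, by linarith, ball_subset_ball' ?_, hq2.le⟩
  linarith

lemma pme_sup {n : ℕ} {Ω : Set (Rn n)} {g : ℝ≥0∞ → ℝ≥0∞} (hm : Monotone g) (h0 : g 0 = 0)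
    (hi : Tendsto (fun t : ℝ≥0 => g t) atTop (𝓝 ∞)) {R : ℝ≥0∞} {κ : ℝ≥0} (hκ : 0 < κ)
    {f : Rn n → ℝ≥0∞} {x : Rn n}
    (H : ∀ (z : Rn n) (r : ℝ), 0 < r → x ∈ ball z r →
      g (κ * ((volume (ball z r))⁻¹ * ∫⁻ y in ball z r ∩ Ω, f y)) ≤ R) :
    g ((κ / 2 : ℝ≥0) * maximal Ω f x) ≤ R := by
  rcases eq_or_ne R ∞ with hR | hR
  · rw [hR]; exact le_top
  obtain ⟨t1, ht1⟩ := (hi.eventually (lt_mem_nhds (lt_top_iff_ne_top.2 hR))).exists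
  have hκ' : (κ : ℝ≥0∞) ≠ 0 := by exact_mod_cast hκ.ne'
  have hfin : maximal Ω f x ≠ ∞ := by
    have : maximal Ω f x ≤ t1 / κ := by
      unfold maximal
      refine iSup_le fun z => iSup_le fun r => iSup_le fun hr => iSup_le fun hx => ?_
      rw [ENNReal.le_div_iff_mul_le (Or.inl hκ') (Or.inl ENNReal.coe_ne_top), mul_comm]
      by_contra hcon
      push Not at hcon
      exact absurd ((hm hcon.le).trans (H z r hr hx)) (not_le.2 ht1)
    exact ne_top_of_le_ne_top (ENNReal.div_ne_top ENNReal.coe_ne_top hκ') this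
  rcases eq_or_ne (maximal Ω f x) 0 with hM | hM
  · rw [hM, mul_zero, h0]; exact zero_le
  have hlt : maximal Ω f x / 2 < maximal Ω f x := ENNReal.half_lt_self hM hfin
  conv_rhs at hlt => unfold maximal
  simp only [lt_iSup_iff] at hlt
  obtain ⟨z, r, hr, hx, hlt⟩ := hlt
  refine (hm ?_).trans (H z r hr hx)
  calc ((κ / 2 : ℝ≥0) : ℝ≥0∞) * maximal Ω f x = κ * (maximal Ω f x / 2) := by
        rw [ENNReal.coe_div two_ne_zero, div_eq_mul_inv, div_eq_mul_inv, ENNReal.coe_ofNat]; ring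
    _ ≤ _ := by gcongr

/-- The estimate on a single ball. -/
lemma pme_ball {n : ℕ} {Ω : Set (Rn n)} (hΩ : IsOpen Ω) {z : Rn n} {r : ℝ} (hr : 0 < r)
    {Ψ : Rn n → ℝ≥0∞ → ℝ≥0∞} {f g : Rn n → ℝ≥0} {x : Rn n} {w : ℝ≥0∞}
    {a β₀ β₁ β₂ H CA Q c K κ : ℝ≥0} (ha : 1 ≤ a) (hβ₀ : 0 < β₀)
    (hQ : Q = CA + 2 * H + 1) (hc : c = (Q + H)⁻¹) (hK0 : 0 < K) (hK1 : 2 ≤ β₁ * K)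
    (hK2 : 2 ≤ β₀ * β₀ * K) (hK3 : 6 * a ≤ β₂ * K) (hκ : κ = (2 * (K * (a / c)))⁻¹)
    (hFm : Measurable fun y => Ψ y (f y)) (hgm : Measurable g)
    (hm : Monotone (Ψ x)) (h0 : Tendsto (fun t : ℝ≥0 => Ψ x t) (𝓝[>] 0) (𝓝 0))
    (hi : Tendsto (fun t : ℝ≥0 => Ψ x t) atTop (𝓝 ∞))
    (hainc : ∀ s t : ℝ≥0, 0 < s → s < t → Ψ x s * t ≤ a * Ψ x t * s)
    (hy : ∀ᵐ y ∂(volume : Measure (Rn n)), y ∈ Ω → Monotone (Ψ y) ∧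
      (∀ s t : ℝ≥0, 0 < s → s < t → Ψ y s * t ≤ a * Ψ y t * s) ∧
      1 ≤ Ψ y (β₀⁻¹ : ℝ≥0) ∧ g y ≤ H)
    (hA0 : Ψ x β₀ ≤ 1)
    (hA1 : w ≤ 1 → ∀ᵐ y ∂(volume : Measure (Rn n)), y ∈ ball z r ∩ Ω →
      ∀ t : ℝ≥0, 1 ≤ Ψ y t → Ψ y t * w ≤ 1 → Ψ x (β₁ * t : ℝ≥0) ≤ Ψ y t)
    (hA2 : ∀ᵐ y ∂(volume : Measure (Rn n)), y ∈ Ω →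
      ∀ t : ℝ≥0, Ψ y t ≤ 1 → Ψ x (β₂ * t : ℝ≥0) ≤ Ψ y t + g x + g y)
    (hgx : g x ≤ H)
    (hAp : ((volume (ball z r))⁻¹ * ∫⁻ y in ball z r ∩ Ω, Ψ y (f y)) * w ≤ CA) :
    Ψ x (κ * ((volume (ball z r))⁻¹ * ∫⁻ y in ball z r ∩ Ω, (f y : ℝ≥0∞))) ≤
      (volume (ball z r))⁻¹ * (∫⁻ y in ball z r ∩ Ω, Ψ y (f y)) +
      (volume (ball z r))⁻¹ * (∫⁻ y in ball z r ∩ Ω, (g y : ℝ≥0∞)) + g x := by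
  set B := ball z r
  have hV0 : volume B ≠ 0 := (measure_ball_pos _ _ hr).ne'
  have hV1 : volume B ≠ ∞ := measure_ball_lt_top.ne
  set A := (volume B)⁻¹ * ∫⁻ y in B ∩ Ω, Ψ y (f y) with hA
  set G := (volume B)⁻¹ * ∫⁻ y in B ∩ Ω, (g y : ℝ≥0∞) with hG
  have hQ1 : 1 ≤ Q := by rw [hQ]; exact le_add_self
  have hc0 : 0 < c := by rw [hc]; positivity
  have hc1 : c ≤ 1 := by
    rw [hc]; exact inv_le_one_of_one_le₀ (hQ1.trans le_self_add)
  have hcQ : c * (Q + H) = 1 := by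
    rw [hc]; exact inv_mul_cancel₀ (by positivity)
  have hac : 1 ≤ a / c := by
    rw [one_le_div hc0]; exact hc1.trans ha
  have hGH : G ≤ H := by
    calc G ≤ (volume B)⁻¹ * ∫⁻ y in B ∩ Ω, (H : ℝ≥0∞) := by
          rw [hG]
          refine mul_le_mul' le_rfl
            (setLIntegral_mono_ae' (measurableSet_ball.inter hΩ.measurableSet) ?_)
          filter_upwards [hy] with y h hyB
          exact_mod_cast (h hyB.2).2.2.2
      _ ≤ (volume B)⁻¹ * (H * volume B) := by
          rw [setLIntegral_const]
          gcongr
          exact inter_subset_left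
      _ = H * ((volume B)⁻¹ * volume B) := by ring
      _ = H := by rw [ENNReal.inv_mul_cancel hV0 hV1, mul_one]
  rcases eq_or_ne A ∞ with hAt | hAt
  · rw [hAt]; simp
  refine ENNReal.le_of_forall_pos_le_add ?_
  intro ε' hε' _
  set ε := min ε' 1 with hε
  have hε0 : 0 < ε := lt_min hε' one_pos
  have hε1 : ε ≤ 1 := min_le_right _ _
  refine le_trans ?_ (add_le_add_right (ENNReal.coe_le_coe.2 (min_le_left ε' 1)) _)
  rw [← hε]
  set α := (A + G + g x + ε).toNNReal with hα
  have hGt : G ≠ ∞ := ne_top_of_le_ne_top ENNReal.coe_ne_top hGH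
  have hαe : (α : ℝ≥0∞) = A + G + g x + ε := by
    rw [hα]; exact ENNReal.coe_toNNReal (by simp [hAt, hGt])
  rw [← hαe]
  have hα0 : 0 < α := by
    have : (ε : ℝ≥0∞) ≤ α := by rw [hαe]; exact le_add_self
    exact hε0.trans_le (by exact_mod_cast this)
  have hgα : g x ≤ α := by
    have : (g x : ℝ≥0∞) ≤ α := by
      rw [hαe]; exact le_add_self.trans le_self_add
    exact_mod_cast this
  obtain ⟨T, hT0, hT1, hT2⟩ := pme_exists_T hm h0 hi hα0
  have hαQ : (α : ℝ≥0∞) ≤ A + (2 * H + 1 : ℝ≥0) := by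
    rw [hαe]
    calc A + G + g x + ε ≤ A + H + H + (1 : ℝ≥0) := by gcongr
      _ = _ := by push_cast; ring
  have hpt : ∀ᵐ y ∂(volume : Measure (Rn n)), y ∈ B ∩ Ω →
      (α : ℝ≥0∞) * f y ≤ (K * T : ℝ≥0) * (α + g y + (a / c : ℝ≥0) * Ψ y (f y)) := by
    by_cases hcase : w ≤ 1 ∧ 1 ≤ α
    · filter_upwards [hy, hA1 hcase.1] with y h1 h2 hyB
      obtain ⟨k1, k2, k3, -⟩ := h1 hyB.2
      refine pme_coreI (w := w) ha hc0 hc1 hcase.2 hT0 hm k1 k2 hT2 ?_ hβ₀ hA0 k3 (h2 hyB) hK0 hK1 hK2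
      calc (c : ℝ≥0∞) * α * w = c * (α * w) := by ring
        _ ≤ c * ((A + (2 * H + 1 : ℝ≥0)) * w) := by gcongr
        _ = c * (A * w + (2 * H + 1 : ℝ≥0) * w) := by ring
        _ ≤ c * (CA + (2 * H + 1 : ℝ≥0) * 1) := by gcongr; exact hcase.1
        _ = (c * Q : ℝ≥0) := by rw [hQ]; push_cast; ring
        _ ≤ (c * (Q + H) : ℝ≥0) := by gcongr; exact le_self_add
        _ = 1 := by rw [hcQ]; simp
    · have hαle : α ≤ Q := by
        rcases le_or_gt w 1 with hw | hw
        · have : α < 1 := by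
            by_contra hcon
            exact hcase ⟨hw, not_lt.1 hcon⟩
          exact this.le.trans hQ1
        · have : (α : ℝ≥0∞) ≤ Q := by
            calc (α : ℝ≥0∞) ≤ A * 1 + (2 * H + 1 : ℝ≥0) := by rw [mul_one]; exact hαQ
              _ ≤ A * w + (2 * H + 1 : ℝ≥0) := by gcongr
              _ ≤ CA + (2 * H + 1 : ℝ≥0) := by gcongr
              _ = Q := by rw [hQ]; push_cast; ring
          exact_mod_cast this
      filter_upwards [hy, hA2] with y h1 h2 hyB
      obtain ⟨-, k2, -, k4⟩ := h1 hyB.2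
      refine pme_coreII ha hc0 hc1 hα0 hT0 hainc k2 hT2 hgα ?_ (h2 hyB.2) hK3
      calc c * (α + g y) ≤ c * (Q + H) := by gcongr
        _ = 1 := hcQ
  have hint := pme_integrate (K := K * (a / c)) (T := T) hr hFm hgm.coe_nnreal_ennreal
    (f := fun y => (f y : ℝ≥0∞)) hα0 (by
      filter_upwards [hpt] with y h hyB
      refine (h hyB).trans ?_
      calc ((K * T : ℝ≥0) : ℝ≥0∞) * (α + g y + (a / c : ℝ≥0) * Ψ y (f y))
          ≤ (K * T : ℝ≥0) * ((a / c : ℝ≥0) * (α + g y) + (a / c : ℝ≥0) * Ψ y (f y)) := by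
            gcongr
            calc (α : ℝ≥0∞) + g y = (1 : ℝ≥0) * (α + g y) := by simp
              _ ≤ _ := by gcongr
        _ = _ := by push_cast; ring) hΩ.measurableSet (by
      rw [hαe, add_assoc (A + G)]; exact le_self_add)
  refine le_trans (hm ?_) hT1
  calc (κ : ℝ≥0∞) * ((volume B)⁻¹ * ∫⁻ y in B ∩ Ω, (f y : ℝ≥0∞))
      ≤ κ * (2 * (K * (a / c)) * T : ℝ≥0) := by gcongr
    _ = T := by
      rw [← ENNReal.coe_mul, hκ]
      congr 1
      have : 0 < a / c := by positivity
      exact inv_mul_cancel_left₀ (by positivity) T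

/-- Pointwise estimate for the maximal function. -/
theorem pointwise_maximal_estimate
    (n : ℕ) (Ω : Set (Rn n)) (hΩ : IsOpen Ω)
    (φ : Rn n → ℝ≥0∞ → ℝ≥0∞) (ω : Rn n → ℝ≥0∞) (p : ℝ) (hp1 : 1 < p)
    (hφ : IsWeakPhi Ω φ) (hA0 : A0 Ω φ) (hA1 : A1w Ω ω φ) (hA2 : A2w Ω ω φ)
    (hInc : AInc Ω φ p) (hω : MuckenhouptAq p ω) :
    ∃ β : ℝ≥0, 0 < β ∧ ∃ h : Rn n → ℝ≥0, MemL1wLinf Ω ω h ∧ ∃ C : ℝ≥0, 0 < C ∧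
      ∀ f : Rn n → ℝ, Measurable f →
        wModular Ω ω φ (fun x => (‖f x‖₊ : ℝ≥0∞)) ≤ 1 →
          ∀ᵐ x ∂(volume : Measure (Rn n)), x ∈ Ω →
            (φ x ((β : ℝ≥0∞) * maximal Ω (fun y => (‖f y‖₊ : ℝ≥0∞)) x)) ^ (1 / p) ≤
              C * (maximal Ω (fun y => (φ y (‖f y‖₊ : ℝ≥0∞)) ^ (1 / p)) x +
                   maximal Ω (fun y => (h y : ℝ≥0∞) ^ (1 / p)) x) := by
  classical
  obtain ⟨β₀, hβ₀, -, hA0⟩ := hA0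
  obtain ⟨β₁, hβ₁, -, hA1⟩ := hA1
  obtain ⟨β₂, hβ₂, -, h, hh, hA2⟩ := hA2 1 one_pos
  obtain ⟨a, ha, hInc⟩ := hInc
  obtain ⟨hw, C, hC, hAp⟩ := hω
  have hhL := hh
  obtain ⟨hhm, -, H, hH⟩ := hh
  have hp0 : 0 < p := by linarith
  have hq0 : 0 < 1 / p := by positivity
  have hq1 : 1 / p ≤ 1 := by rw [div_le_one hp0]; exact hp1.le
  set Ψ : Rn n → ℝ≥0∞ → ℝ≥0∞ := fun x t => (φ x t) ^ (1 / p) with hΨ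
  set g : Rn n → ℝ≥0 := fun x => (h x) ^ (1 / p) with hg
  have hgm : Measurable g := hhm.pow_const _
  have hgc : ∀ y, ((h y : ℝ≥0∞)) ^ (1 / p) = (g y : ℝ≥0∞) := fun y =>
    (ENNReal.coe_rpow_of_nonneg _ hq0.le).symm
  set H1 := H ^ (1 / p) with hH1
  set CA := C.toNNReal ^ (1 / p) with hCA
  have hCA' : C ^ (1 / p) = (CA : ℝ≥0∞) := by
    rw [hCA, ENNReal.coe_rpow_of_nonneg _ hq0.le, ENNReal.coe_toNNReal hC]
  set Q := CA + 2 * H1 + 1 with hQ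
  set c := (Q + H1)⁻¹ with hc
  set K := 6 * a / β₂ + 2 / β₁ + 2 / (β₀ * β₀) with hK
  have ha0 : 0 < a := by positivity
  have hc0 : 0 < c := by positivity
  have hK0 : 0 < K := by positivity
  have hK1 : 2 ≤ β₁ * K := by
    calc 2 = β₁ * (2 / β₁) := by field_simp
      _ ≤ β₁ * K := by gcongr; rw [hK, add_right_comm]; exact le_add_self
  have hK2 : 2 ≤ β₀ * β₀ * K := by
    calc 2 = β₀ * β₀ * (2 / (β₀ * β₀)) := by field_simp
      _ ≤ β₀ * β₀ * K := by gcongr; rw [hK]; exact le_add_self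
  have hK3 : 6 * a ≤ β₂ * K := by
    calc 6 * a = β₂ * (6 * a / β₂) := by field_simp
      _ ≤ β₂ * K := by gcongr; rw [hK, add_assoc]; exact le_self_add
  set κ := (2 * (K * (a / c)))⁻¹ with hκ
  have hκ0 : 0 < κ := by positivity
  set κ' := κ / 2 ^ n with hκ'
  have hκ'0 : 0 < κ' := by positivity
  have hgH : ∀ᵐ x ∂(volume : Measure (Rn n)), x ∈ Ω → g x ≤ H1 := by
    filter_upwards [hH] with x hx hxΩ
    exact NNReal.rpow_le_rpow (hx hxΩ) hq0.le
  -- the properties of `φ(y, ·)` at almost every `y`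
  have hmono : ∀ᵐ x ∂(volume : Measure (Rn n)), x ∈ Ω → Monotone (Ψ x) := by
    filter_upwards [hφ.mono] with x hx hxΩ s t hst
    exact ENNReal.rpow_le_rpow (hx hxΩ hst) hq0.le
  have hroot : ∀ᵐ x ∂(volume : Measure (Rn n)), x ∈ Ω →
      ∀ s t : ℝ≥0, 0 < s → s < t → Ψ x s * t ≤ a * Ψ x t * s := by
    filter_upwards [hInc] with x hx hxΩ s t hs hst
    exact pme_root_ainc hp1 ha (hx hxΩ) s t hs hst
  have hA0' : ∀ᵐ x ∂(volume : Measure (Rn n)), x ∈ Ω →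
      Ψ x β₀ ≤ 1 ∧ 1 ≤ Ψ x (β₀⁻¹ : ℝ≥0) := by
    filter_upwards [hA0] with x hx hxΩ
    refine ⟨ENNReal.rpow_le_one (hx hxΩ).1 hq0.le, ENNReal.one_le_rpow ?_ hq0⟩
    rw [ENNReal.coe_inv hβ₀.ne']
    exact (hx hxΩ).2
  have hyall : ∀ᵐ y ∂(volume : Measure (Rn n)), y ∈ Ω → Monotone (Ψ y) ∧
      (∀ s t : ℝ≥0, 0 < s → s < t → Ψ y s * t ≤ a * Ψ y t * s) ∧
      1 ≤ Ψ y (β₀⁻¹ : ℝ≥0) ∧ g y ≤ H1 := by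
    filter_upwards [hmono, hroot, hA0', hgH] with y h1 h2 h3 h4 hy
    exact ⟨h1 hy, h2 hy, (h3 hy).2, h4 hy⟩
  have hone : ∀ u : ℝ≥0∞, 1 ≤ u ^ (1 / p) → 1 ≤ u := by
    intro u hu
    by_contra hcon
    exact absurd hu (not_le.2 (ENNReal.rpow_lt_one (not_le.1 hcon) hq0))
  have hone' : ∀ u : ℝ≥0∞, u ^ (1 / p) ≤ 1 → u ≤ 1 := by
    intro u hu
    by_contra hcon
    exact absurd hu (not_le.2 (ENNReal.one_lt_rpow (not_le.1 hcon) hq0))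
  have hA1' : ∀ᵐ x ∂(volume : Measure (Rn n)), ∀ (k : ℕ) (q : ℚ), (0 : ℝ) < q →
      x ∈ ball (TopologicalSpace.denseSeq (Rn n) k) q → x ∈ Ω →
      (wSet ω (ball (TopologicalSpace.denseSeq (Rn n) k) q)) ^ (1 / p) ≤ 1 →
      ∀ᵐ y ∂(volume : Measure (Rn n)), y ∈ ball (TopologicalSpace.denseSeq (Rn n) k) q ∩ Ω →
      ∀ t : ℝ≥0, 1 ≤ Ψ y t →
        Ψ y t * (wSet ω (ball (TopologicalSpace.denseSeq (Rn n) k) q)) ^ (1 / p) ≤ 1 →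
        Ψ x (β₁ * t : ℝ≥0) ≤ Ψ y t := by
    rw [ae_all_iff]; intro k
    rw [ae_all_iff]; intro q
    by_cases hq : (0 : ℝ) < q
    swap
    · exact Eventually.of_forall fun x h => absurd h hq
    by_cases hW : (wSet ω (ball (TopologicalSpace.denseSeq (Rn n) k) q)) ^ (1 / p) ≤ 1
    swap
    · exact Eventually.of_forall fun x _ _ _ h => absurd h hW
    filter_upwards [hA1 (TopologicalSpace.denseSeq (Rn n) k) q hq (hone' _ hW)]
      with x hx _ hxB hxΩ _
    filter_upwards [hx] with y hy hyB t ht1 ht2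
    have ht2' := hone' (φ y t * wSet ω (ball (TopologicalSpace.denseSeq (Rn n) k) q)) (by
      rw [ENNReal.mul_rpow_of_nonneg _ _ hq0.le]; exact ht2)
    have := hy ⟨hxB, hxΩ⟩ hyB t (hone _ ht1) (by
      rw [ENNReal.le_inv_iff_mul_le]; exact ht2')
    rw [← ENNReal.coe_mul] at this
    exact ENNReal.rpow_le_rpow this hq0.le
  have hA2' : ∀ᵐ x ∂(volume : Measure (Rn n)), x ∈ Ω →
      ∀ᵐ y ∂(volume : Measure (Rn n)), y ∈ Ω →
      ∀ t : ℝ≥0, Ψ y t ≤ 1 → Ψ x (β₂ * t : ℝ≥0) ≤ Ψ y t + g x + g y := by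
    filter_upwards [hA2] with x hx hxΩ
    filter_upwards [hx] with y hy hyΩ t ht
    have := hy hxΩ hyΩ t (by simpa using hone' _ ht)
    rw [← ENNReal.coe_mul] at this
    calc Ψ x (β₂ * t : ℝ≥0) ≤ (φ y t + h x + h y) ^ (1 / p) := ENNReal.rpow_le_rpow this hq0.le
      _ ≤ (φ y t + h x) ^ (1 / p) + (h y : ℝ≥0∞) ^ (1 / p) :=
        ENNReal.rpow_add_le_add_rpow _ _ hq0.le hq1
      _ ≤ (φ y t) ^ (1 / p) + (h x : ℝ≥0∞) ^ (1 / p) + (h y : ℝ≥0∞) ^ (1 / p) := by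
        gcongr; exact ENNReal.rpow_add_le_add_rpow _ _ hq0.le hq1
      _ = _ := by rw [hgc, hgc]
  have hleb := pme_lebesgue hΩ hgm hgH
  refine ⟨κ' / 2, by positivity, h, hhL, 1 + 2 ^ n, by positivity, ?_⟩
  intro f hf hmod
  have hfm : Measurable fun y => ‖f y‖₊ := hf.nnnorm
  have hφm : Measurable fun y => φ y (‖f y‖₊ : ℝ≥0∞) := hφ.meas _ hfm.coe_nnreal_ennreal
  have hFm : Measurable fun y => Ψ y (‖f y‖₊ : ℝ≥0∞) := hφm.pow_const _
  filter_upwards [hmono, hroot, hA0', hgH, hA1', hA2', hleb, hφ.map_zero, hφ.tendsto_zero,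
    hφ.tendsto_top] with x xm xr xA0 xg xA1 xA2 xleb xz xt0 xt1 hxΩ
  have hz : Ψ x 0 = 0 := by simp only [hΨ]; rw [xz hxΩ, ENNReal.zero_rpow_of_pos hq0]
  have ht0 : Tendsto (fun t : ℝ≥0 => Ψ x t) (𝓝[>] 0) (𝓝 0) := by
    have := (ENNReal.continuous_rpow_const (y := 1 / p)).tendsto 0
    rw [ENNReal.zero_rpow_of_pos hq0] at this
    exact this.comp (xt0 hxΩ)
  have ht1 : Tendsto (fun t : ℝ≥0 => Ψ x t) atTop (𝓝 ∞) := by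
    have := (ENNReal.continuous_rpow_const (y := 1 / p)).tendsto ∞
    rw [ENNReal.top_rpow_of_pos hq0] at this
    exact this.comp (xt1 hxΩ)
  simp only [hgc]
  set MF := maximal Ω (fun y => φ y (‖f y‖₊ : ℝ≥0∞) ^ (1 / p)) x with hMF
  set Mg := maximal Ω (fun y => (g y : ℝ≥0∞)) x with hMg
  refine pme_sup (g := Ψ x) (xm hxΩ) hz ht1 hκ'0 ?_
  intro z r hr hxB
  obtain ⟨k, q, hq, hsub, hqr⟩ := pme_rational z hr
  set z' := TopologicalSpace.denseSeq (Rn n) k with hz'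
  have hb := pme_ball (w := (wSet ω (ball z' q)) ^ (1 / p)) (f := fun y => ‖f y‖₊) hΩ hq ha hβ₀
    hQ hc hK0 hK1 hK2 hK3 hκ hFm hgm (xm hxΩ) ht0 ht1 (xr hxΩ) hyall (xA0 hxΩ).1
    (xA1 k q hq (hsub hxB) hxΩ) (xA2 hxΩ) (xg hxΩ)
    (by rw [← hCA']; exact pme_Ap hp1 hw (hAp z' q hq) hφm hmod)
  have hV0 : volume (ball z r) ≠ 0 := (measure_ball_pos _ _ hr).ne'
  have hV1 : volume (ball z r) ≠ ∞ := measure_ball_lt_top.ne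
  have hV0' : volume (ball z' (q : ℝ)) ≠ 0 := (measure_ball_pos _ _ hq).ne'
  have hV1' : volume (ball z' (q : ℝ)) ≠ ∞ := measure_ball_lt_top.ne
  have hinv : (volume (ball z r))⁻¹ ≤ (2 ^ n : ℝ≥0) * (volume (ball z' (q : ℝ)))⁻¹ := by
    rw [← div_eq_mul_inv, ENNReal.le_div_iff_mul_le (Or.inl hV0') (Or.inl hV1'), mul_comm,
      ← div_eq_mul_inv]
    exact ENNReal.div_le_of_le_mul (pme_vol_double z z' hr hqr)
  calc Ψ x (κ' * ((volume (ball z r))⁻¹ * ∫⁻ y in ball z r ∩ Ω, (‖f y‖₊ : ℝ≥0∞)))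
      ≤ Ψ x (κ * ((volume (ball z' (q : ℝ)))⁻¹ *
          ∫⁻ y in ball z' (q : ℝ) ∩ Ω, (‖f y‖₊ : ℝ≥0∞))) := by
        apply xm hxΩ
        calc (κ' : ℝ≥0∞) * ((volume (ball z r))⁻¹ * ∫⁻ y in ball z r ∩ Ω, (‖f y‖₊ : ℝ≥0∞))
            ≤ κ' * (((2 ^ n : ℝ≥0) * (volume (ball z' (q : ℝ)))⁻¹) *
              ∫⁻ y in ball z' (q : ℝ) ∩ Ω, (‖f y‖₊ : ℝ≥0∞)) :=
              mul_le_mul' le_rfl (mul_le_mul' hinv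
                (lintegral_mono_set (inter_subset_inter_left _ hsub)))
          _ = (κ' * 2 ^ n : ℝ≥0) * ((volume (ball z' (q : ℝ)))⁻¹ *
              ∫⁻ y in ball z' (q : ℝ) ∩ Ω, (‖f y‖₊ : ℝ≥0∞)) := by push_cast; ring
          _ = _ := by rw [hκ', div_mul_cancel₀ _ (by positivity)]
    _ ≤ _ := hb
    _ ≤ MF + Mg + (2 ^ n : ℝ≥0) * Mg := by
        gcongr
        · exact pme_le_maximal hq (hsub hxB)
        · exact pme_le_maximal hq (hsub hxB)
        · exact xleb hxΩ
    _ ≤ (MF + Mg) + (2 ^ n : ℝ≥0) * (MF + Mg) := by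
        gcongr
        exact le_add_self
    _ = _ := by push_cast; ring
end
end
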